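/- Let A be the 6×6 Cartan matrix of type E_6 with nodes labeled so that nodes 1–2–3–4–5 form a chain and node 6 is attached to node 3 (A_{ii} = 2; A_{ij} = −1 exactly when {i,j} ∈ {{1,2},{2,3},{3,4},{4,5},{3,6}}; A_{ij} = 0 otherwise). Let Φ⁺ = { c ∈ ℕ^6 : cᵀ A c = 2 }, which has exactly 36 elements (the positive roots of E_6). Then in ℤ[[q, y_1, …, y_6]]: ∏_{c ∈ Φ⁺} ∏_{n≥1} (1 − q^n y_1^{c_1} ⋯ y_6^{c_6})^{−1} = ∑ over all 6-tuples (r_1, …, r_6) of descending sequences of q^{E} · ( ∏_{i=1}^{6} y_i^{|r_i|} ) · ∏_{i=1}^{6} ∏_{j≥1} (q;q)_{r_i^{(j)} − r_i^{(j+1)}}^{−1}, where E = ∑_{i=1}^{6} ∑_{t≥1} (r_i^{(t)})² − ∑_{t≥1} ( r_1^{(t)} r_2^{(t)} + r_2^{(t)} r_3^{(t)} + r_3^{(t)} r_4^{(t)} + r_4^{(t)} r_5^{(t)} + r_3^{(t)} r_6^{(t)} ); here E is a nonnegative integer. -/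

import Mathlib

open MvPowerSeries

/-- The product topology (coefficientwise convergence) on multivariate formal power series. -/
noncomputable instance (σ R : Type*) [TopologicalSpace R] :
    TopologicalSpace (MvPowerSeries σ R) :=
  inferInstanceAs (TopologicalSpace ((σ →₀ ℕ) → R))

/-- `r : ℕ → ℕ` is a descending sequence (indexed so that `r t = r^{(t+1)}`):
nonincreasing and eventually zero. -/
def IsDescending (r : ℕ → ℕ) : Prop :=
  Antitone r ∧ ∃ N, ∀ t ≥ N, r t = 0

/-- The Cartan matrix of type `E₆` (0-indexed: nodes `0–1–2–3–4` form a chain and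
node `5` is attached to node `2`; these are the paper's nodes `1,…,6`). -/
def cartanE6 : Matrix (Fin 6) (Fin 6) ℤ :=
  !![ 2, -1,  0,  0,  0,  0;
     -1,  2, -1,  0,  0,  0;
      0, -1,  2, -1,  0, -1;
      0,  0, -1,  2, -1,  0;
      0,  0,  0, -1,  2,  0;
      0,  0, -1,  0,  0,  2]

theorem finsum_eq_sum_range {M : Type*} [AddCommMonoid M] {f : ℕ → M} {L : ℕ}
    (h : ∀ t ≥ L, f t = 0) : ∑ᶠ t, f t = ∑ t ∈ Finset.range L, f t := by
  refine finsum_eq_sum_of_support_subset f fun t ht => ?_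
  by_contra hn
  exact ht (h t (by simpa using hn))

theorem finprod_eq_prod_range {M : Type*} [CommMonoid M] {f : ℕ → M} {L : ℕ}
    (h : ∀ t ≥ L, f t = 1) : ∏ᶠ t, f t = ∏ t ∈ Finset.range L, f t := by
  refine finprod_eq_prod_of_mulSupport_subset f fun t ht => ?_
  by_contra hn
  exact ht (h t (by simpa using hn))

namespace IsDescending

theorem zero : IsDescending 0 := ⟨fun _ _ _ => le_rfl, 0, fun _ _ => rfl⟩

theorem eq_zero_of_sum_le {l : ℕ → ℕ} (hl : IsDescending l) {N t : ℕ} (hN : ∑ᶠ t, l t ≤ N)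
    (ht : N ≤ t) : l t = 0 := by
  obtain ⟨ha, L, hL⟩ := hl
  by_contra hne
  have hlt : t < L := by
    by_contra h
    exact hne (hL t (not_lt.mp h))
  rw [finsum_eq_sum_range hL] at hN
  have h1 : ∑ s ∈ Finset.range (t + 1), 1 ≤ ∑ s ∈ Finset.range (t + 1), l s :=
    Finset.sum_le_sum fun s hs => by
      have := ha (Nat.lt_succ_iff.mp (Finset.mem_range.mp hs))
      omega
  have h2 : ∑ s ∈ Finset.range (t + 1), l s ≤ ∑ s ∈ Finset.range L, l s :=
    Finset.sum_le_sum_of_subset (Finset.range_mono hlt)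
  simp at h1
  omega

theorem le_sum {l : ℕ → ℕ} (hl : IsDescending l) (t : ℕ) : l t ≤ ∑ᶠ t, l t := by
  obtain ⟨L, hL⟩ := hl.2
  rw [finsum_eq_sum_range hL]
  by_cases h : t < L
  · exact Finset.single_le_sum (f := l) (fun _ _ => Nat.zero_le _) (Finset.mem_range.mpr h)
  · simp [hL t (not_lt.mp h)]

theorem add {l m : ℕ → ℕ} (hl : IsDescending l) (hm : IsDescending m) :
    IsDescending (l + m) := by
  obtain ⟨ha, L, hL⟩ := hl
  obtain ⟨hb, M, hM⟩ := hm
  refine ⟨ha.add hb, max L M, fun t ht => ?_⟩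
  simp [hL t (le_trans (le_max_left _ _) ht), hM t (le_trans (le_max_right _ _) ht)]

theorem smul (k : ℕ) {l : ℕ → ℕ} (hl : IsDescending l) : IsDescending (k • l) := by
  obtain ⟨ha, L, hL⟩ := hl
  exact ⟨fun a b h => Nat.mul_le_mul_left k (ha h), L, fun t ht => by simp [hL t ht]⟩

theorem sum {ι : Type*} (s : Finset ι) (f : ι → ℕ → ℕ) (h : ∀ i ∈ s, IsDescending (f i)) :
    IsDescending (∑ i ∈ s, f i) := by
  classical
  induction s using Finset.induction_on with
  | empty => simpa using zero
  | insert a s ha ih =>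
    rw [Finset.sum_insert ha]
    exact (h a (by simp)).add (ih fun i hi => h i (by simp [hi]))

end IsDescending

theorem finite_descending (N : ℕ) :
    {l : ℕ → ℕ | IsDescending l ∧ ∑ᶠ t, l t = N}.Finite := by
  have hinj : Set.InjOn (fun (l : ℕ → ℕ) (t : Fin N) => l t)
      {l : ℕ → ℕ | IsDescending l ∧ ∑ᶠ t, l t = N} := by
    rintro l ⟨hl, hlN⟩ m ⟨hm, hmN⟩ h
    funext t
    by_cases ht : t < N
    · exact congrFun h ⟨t, ht⟩
    · rw [hl.eq_zero_of_sum_le hlN.le (not_lt.mp ht), hm.eq_zero_of_sum_le hmN.le (not_lt.mp ht)]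
  refine Set.Finite.of_finite_image ?_ hinj
  refine (Set.Finite.pi' (t := fun _ : Fin N => Set.Iic N)
    (fun _ => Set.finite_Iic N)).subset ?_
  rintro _ ⟨l, ⟨hl, hlN⟩, rfl⟩ t
  exact hlN ▸ hl.le_sum t

/-- The finite set of descending sequences with sum `N`. -/
noncomputable def descendingWithSum (N : ℕ) : Finset (ℕ → ℕ) := (finite_descending N).toFinset

@[simp]
theorem mem_descendingWithSum {N : ℕ} {l : ℕ → ℕ} :
    l ∈ descendingWithSum N ↔ IsDescending l ∧ ∑ᶠ t, l t = N := by
  simp [descendingWithSum]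

theorem descendingWithSum_zero : descendingWithSum 0 = {0} := by
  ext l
  simp only [mem_descendingWithSum, Finset.mem_singleton]
  refine ⟨fun ⟨h, h0⟩ => funext fun t => h.eq_zero_of_sum_le h0.le (Nat.zero_le t), ?_⟩
  rintro rfl
  exact ⟨IsDescending.zero, by simp⟩

/-- The finite `q`-Pochhammer symbol `(q;q)_m`. -/
def qPoch {R : Type*} [CommRing R] (q : R) (m : ℕ) : R := ∏ u ∈ Finset.range m, (1 - q ^ (u + 1))

theorem qPoch_zero {R : Type*} [CommRing R] (q : R) : qPoch q 0 = 1 := by simp [qPoch]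

theorem qPoch_succ {R : Type*} [CommRing R] (q : R) (m : ℕ) :
    qPoch q (m + 1) = qPoch q m * (1 - q ^ (m + 1)) := Finset.prod_range_succ _ _

/-- `∏_j (q;q)_{l_j - l_{j+1}}`. -/
noncomputable def pochProd {R : Type*} [CommRing R] (q : R) (l : ℕ → ℕ) : R :=
  ∏ᶠ j, qPoch q (l j - l (j + 1))

theorem pochProd_eq_range {R : Type*} [CommRing R] (q : R) {l : ℕ → ℕ} {L : ℕ}
    (h : ∀ t ≥ L, l t = 0) :
    pochProd q l = ∏ j ∈ Finset.range L, qPoch q (l j - l (j + 1)) :=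
  finprod_eq_prod_range fun t ht => by simp [h t ht, qPoch_zero]

/-- The pairing `∑_t c_t l_t`. -/
noncomputable def pairing (c : ℕ → ℤ) (l : ℕ → ℕ) : ℤ := ∑ᶠ t, c t * l t

theorem pairing_eq_range (c : ℕ → ℤ) {l : ℕ → ℕ} {L : ℕ} (h : ∀ t ≥ L, l t = 0) :
    pairing c l = ∑ t ∈ Finset.range L, c t * l t :=
  finsum_eq_sum_range fun t ht => by simp [h t ht]

theorem pairing_add (c d : ℕ → ℤ) {l : ℕ → ℕ} (hl : IsDescending l) :
    pairing (c + d) l = pairing c l + pairing d l := by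
  obtain ⟨L, hL⟩ := hl.2
  simp [pairing_eq_range _ hL, add_mul, Finset.sum_add_distrib]

theorem pairing_single (s : ℕ) (l : ℕ → ℕ) : pairing (Pi.single s 1) l = l s := by
  rw [pairing, finsum_eq_single _ s fun t ht => by simp [ht]]
  simp

theorem pairing_add_single (c : ℕ → ℤ) {l : ℕ → ℕ} (hl : IsDescending l) (s : ℕ) :
    pairing (c + Pi.single s 1) l = pairing c l + l s := by
  rw [pairing_add _ _ hl, pairing_single]

theorem pairing_sub_single (c : ℕ → ℤ) {l : ℕ → ℕ} (hl : IsDescending l) (s : ℕ) :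
    pairing (c - Pi.single s 1) l = pairing c l - l s := by
  have := pairing_add_single (c - Pi.single s 1) hl s
  rw [sub_add_cancel] at this
  omega

theorem pairing_zero (l : ℕ → ℕ) : pairing 0 l = 0 := by simp [pairing]

/-- The sum of squares `∑_t l_t²`. -/
noncomputable def sumSq (l : ℕ → ℕ) : ℤ := ∑ᶠ t, (l t : ℤ) ^ 2

theorem sumSq_eq_range {l : ℕ → ℕ} {L : ℕ} (h : ∀ t ≥ L, l t = 0) :
    sumSq l = ∑ t ∈ Finset.range L, (l t : ℤ) ^ 2 :=
  finsum_eq_sum_range fun t ht => by simp [h t ht]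

section bump

variable {l : ℕ → ℕ} {s : ℕ}

theorem IsDescending.bump (hl : IsDescending l) (hs : s = 0 ∨ l s < l (s - 1)) :
    IsDescending (l + Pi.single s 1) := by
  obtain ⟨ha, L, hL⟩ := hl
  refine ⟨antitone_nat_of_succ_le fun n => ?_, max L (s + 1), fun t ht => ?_⟩
  · have := ha (Nat.le_succ n)
    simp only [Pi.add_apply, Pi.single_apply]
    split_ifs with h1 h2
    · omega
    · have h3 : s - 1 = n := by omega
      rw [h3, ← h1] at hs
      simp only [Nat.succ_eq_add_one] at *
      omega
    · simp only [Nat.succ_eq_add_one] at *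
      omega
    · simpa using this
  · have h1 : t ≠ s := by
      have := le_trans (le_max_right _ _) ht
      omega
    simp [hL t (le_trans (le_max_left _ _) ht), h1]

theorem IsDescending.unbump (hl : IsDescending l) (hs : l (s + 1) < l s) :
    IsDescending (l - Pi.single s 1) := by
  obtain ⟨ha, L, hL⟩ := hl
  refine ⟨antitone_nat_of_succ_le fun n => ?_, L, fun t ht => by simp [hL t ht]⟩
  have := ha (Nat.le_succ n)
  simp only [Pi.sub_apply, Pi.single_apply, Nat.succ_eq_add_one] at *
  by_cases h1 : n = s
  · subst h1
    simp
    omega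
  · simp only [h1, if_false]
    split_ifs <;> omega

theorem unbump_add_single (hs : l (s + 1) < l s) : l - Pi.single s 1 + Pi.single s 1 = l := by
  funext t
  by_cases h : t = s
  · subst h
    simp
    omega
  · simp [h]

theorem bump_vanish {L : ℕ} (hL : ∀ t ≥ L, l t = 0) (hs : s < L) :
    ∀ t ≥ L, (l + Pi.single s 1 : ℕ → ℕ) t = 0 := fun t ht => by
  have : t ≠ s := by omega
  simp [hL t ht, this]

theorem IsDescending.exists_bound (hl : IsDescending l) (s : ℕ) :
    ∃ L, s < L ∧ ∀ t ≥ L, l t = 0 := by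
  obtain ⟨L, hL⟩ := hl.2
  exact ⟨max L (s + 1), lt_of_lt_of_le (Nat.lt_succ_self s) (le_max_right _ _),
    fun t ht => hL t (le_trans (le_max_left _ _) ht)⟩

theorem sum_bump (hl : IsDescending l) :
    ∑ᶠ t, (l + Pi.single s 1 : ℕ → ℕ) t = ∑ᶠ t, l t + 1 := by
  obtain ⟨L, hs, hL⟩ := hl.exists_bound s
  rw [finsum_eq_sum_range (bump_vanish hL hs), finsum_eq_sum_range hL]
  simp [Finset.sum_add_distrib, Pi.single_apply, hs]

theorem pairing_bump (c : ℕ → ℤ) (hl : IsDescending l) :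
    pairing c (l + Pi.single s 1) = pairing c l + c s := by
  obtain ⟨L, hs, hL⟩ := hl.exists_bound s
  rw [pairing_eq_range _ (bump_vanish hL hs), pairing_eq_range _ hL]
  simp [mul_add, Finset.sum_add_distrib, Pi.single_apply, hs]

theorem sumSq_bump (hl : IsDescending l) :
    sumSq (l + Pi.single s 1) = sumSq l + (2 * l s + 1) := by
  obtain ⟨L, hs, hL⟩ := hl.exists_bound s
  rw [sumSq_eq_range (bump_vanish hL hs), sumSq_eq_range hL]
  have : ∀ t, (((l + Pi.single s 1 : ℕ → ℕ) t : ℕ) : ℤ) ^ 2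
      = (l t : ℤ) ^ 2 + if t = s then 2 * (l s : ℤ) + 1 else 0 := fun t => by
    by_cases h : t = s
    · subst h
      simp
      ring
    · simp [h]
  rw [Finset.sum_congr rfl fun t _ => this t, Finset.sum_add_distrib]
  simp [hs]

theorem pochProd_bump {R : Type*} [CommRing R] (q : R) (hl : IsDescending l)
    (hs : s = 0 ∨ l s < l (s - 1)) :
    pochProd q (l + Pi.single s 1) * (if s = 0 then 1 else 1 - q ^ (l (s - 1) - l s))
      = pochProd q l * (1 - q ^ (l s + 1 - l (s + 1))) := by
  obtain ⟨L, hsL, hL⟩ := hl.exists_bound s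
  have hanti := hl.1
  rw [pochProd_eq_range _ (bump_vanish hL hsL), pochProd_eq_range _ hL]
  have e1 : (if s = 0 then 1 else 1 - q ^ (l (s - 1) - l s))
      = ∏ j ∈ Finset.range L, if j + 1 = s then 1 - q ^ (l j - l s) else 1 := by
    rcases s with _ | s
    · simp
    · simp only [Nat.add_right_cancel_iff, Finset.prod_ite_eq', Finset.mem_range]
      have hlt : s < L := by omega
      simp [hlt]
  have e2 : (1 - q ^ (l s + 1 - l (s + 1)))
      = ∏ j ∈ Finset.range L, if j = s then 1 - q ^ (l s + 1 - l (s + 1)) else 1 := by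
    simp [hsL]
  rw [e1, e2, ← Finset.prod_mul_distrib, ← Finset.prod_mul_distrib]
  refine Finset.prod_congr rfl fun j _ => ?_
  by_cases h1 : j = s
  · subst h1
    have := hanti (Nat.le_succ j)
    simp only [Nat.succ_eq_add_one] at this
    have h2 : l j + 1 - l (j + 1) = (l j - l (j + 1)) + 1 := by omega
    simp [h2, qPoch_succ]
  · by_cases h2 : j + 1 = s
    · subst h2
      have h3 : l j - l (j + 1) = (l j - (l (j + 1) + 1)) + 1 := by
        simp at hs
        omega
      have h4 : qPoch q (l j - l (j + 1))
          = qPoch q (l j - (l (j + 1) + 1)) * (1 - q ^ (l j - l (j + 1))) := by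
        rw [h3, qPoch_succ]
      simp [h4]
    · simp [h1, h2]

end bump

section recurrence

variable {K : Type*} [Field K] {q : K}

theorem qPoch_ne_zero (hq : ∀ n : ℕ, q ^ (n + 1) ≠ 1) (m : ℕ) : qPoch q m ≠ 0 :=
  Finset.prod_ne_zero_iff.mpr fun u _ => sub_ne_zero.mpr (hq u).symm

theorem pochProd_ne_zero (hq : ∀ n : ℕ, q ^ (n + 1) ≠ 1) {l : ℕ → ℕ} (hl : IsDescending l) :
    pochProd q l ≠ 0 := by
  obtain ⟨L, hL⟩ := hl.2
  rw [pochProd_eq_range q hL]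
  exact Finset.prod_ne_zero_iff.mpr fun u _ => qPoch_ne_zero hq _

/-- The sum of `q^{∑ l_t² - ∑ c_t l_t} / ∏_j (q;q)_{l_j - l_{j+1}}` over descending sequences
`l` with sum `N`. -/
noncomputable def descSum (q : K) (N : ℕ) (c : ℕ → ℤ) : K :=
  ∑ l ∈ descendingWithSum N, q ^ (sumSq l - pairing c l) / pochProd q l

theorem descSum_zero_left (q : K) (c : ℕ → ℤ) : descSum q 0 c = 1 := by
  simp [descSum, descendingWithSum_zero, sumSq, pairing, pochProd, qPoch]

theorem descSum_congr (q : K) {N : ℕ} {c d : ℕ → ℤ} (h : ∀ t < N, c t = d t) :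
    descSum q N c = descSum q N d := by
  refine Finset.sum_congr rfl fun l hl => ?_
  obtain ⟨hl, hN⟩ := mem_descendingWithSum.mp hl
  have hz : ∀ t ≥ N, l t = 0 := fun t ht => hl.eq_zero_of_sum_le hN.le ht
  rw [pairing_eq_range c hz, pairing_eq_range d hz,
    Finset.sum_congr rfl fun t ht => by rw [h t (Finset.mem_range.mp ht)]]

/-- `descSum` with the exponent of index `s - 1` lowered, and `0` when `s = 0`. -/
noncomputable def descSumPred (q : K) (N : ℕ) (c : ℕ → ℤ) (s : ℕ) : K :=
  if s = 0 then 0 else descSum q N (c - Pi.single (s - 1) 1)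

theorem descSumPred_succ (q : K) (N : ℕ) (c : ℕ → ℤ) (s : ℕ) :
    descSumPred q N c (s + 1) = descSum q N (c - Pi.single s 1) := by
  simp [descSumPred]

theorem descSum_bump_term (hq0 : q ≠ 0) (hq : ∀ n : ℕ, q ^ (n + 1) ≠ 1) (c : ℕ → ℤ)
    {s : ℕ} {l : ℕ → ℕ} (hl : IsDescending l) (hs : s = 0 ∨ l s < l (s - 1)) :
    q ^ (sumSq (l + Pi.single s 1) - pairing c (l + Pi.single s 1)
          - ((l + Pi.single s 1 : ℕ → ℕ) s : ℤ)) / pochProd q (l + Pi.single s 1)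
        * (1 - q ^ ((l + Pi.single s 1 : ℕ → ℕ) s - (l + Pi.single s 1 : ℕ → ℕ) (s + 1)))
      = q ^ (-c s) * (q ^ (sumSq l - pairing c l + l s) / pochProd q l
        * (if s = 0 then 1 else 1 - q ^ (l (s - 1) - l s))) := by
  rw [sumSq_bump hl, pairing_bump c hl]
  have hB := pochProd_bump q hl hs
  have h1 := pochProd_ne_zero hq hl
  have h2 := pochProd_ne_zero hq (hl.bump hs)
  have h3 : (l + Pi.single s 1 : ℕ → ℕ) s - (l + Pi.single s 1 : ℕ → ℕ) (s + 1)
      = l s + 1 - l (s + 1) := by simp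
  have h4 : sumSq l + (2 * (l s : ℤ) + 1) - (pairing c l + c s)
      - ((l + Pi.single s 1 : ℕ → ℕ) s : ℤ) = -c s + (sumSq l - pairing c l + l s) := by
    simp
    ring
  rw [h3, h4, zpow_add₀ hq0]
  generalize (if s = 0 then (1 : K) else 1 - q ^ (l (s - 1) - l s)) = D at *
  field_simp
  linear_combination (-1 : K) * hB

theorem descSum_step (hq0 : q ≠ 0) (hq : ∀ n : ℕ, q ^ (n + 1) ≠ 1) (N : ℕ) (c : ℕ → ℤ) (s : ℕ) :
    descSum q (N + 1) (c + Pi.single s 1) - descSum q (N + 1) (c + Pi.single (s + 1) 1)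
      = q ^ (-c s) * (descSumPred q N c (s + 1) - descSumPred q N c s) := by
  have hL : descSum q (N + 1) (c + Pi.single s 1) - descSum q (N + 1) (c + Pi.single (s + 1) 1)
      = ∑ l ∈ descendingWithSum (N + 1) with l (s + 1) < l s,
        q ^ (sumSq l - pairing c l - l s) / pochProd q l * (1 - q ^ (l s - l (s + 1))) := by
    rw [Finset.sum_filter_of_ne, descSum, descSum, ← Finset.sum_sub_distrib]
    · refine Finset.sum_congr rfl fun l hl => ?_
      obtain ⟨hl, -⟩ := mem_descendingWithSum.mp hl
      have hle := hl.1 (Nat.le_succ s)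
      have e : sumSq l - (pairing c l + l (s + 1))
          = sumSq l - pairing c l - l s + ((l s - l (s + 1) : ℕ) : ℤ) := by
        push_cast [hle]
        ring
      rw [pairing_add_single c hl, pairing_add_single c hl, e, zpow_add₀ hq0, zpow_natCast,
        sub_add_eq_sub_sub]
      ring
    · intro l hl hne
      obtain ⟨hl, -⟩ := mem_descendingWithSum.mp hl
      refine lt_of_le_of_ne (hl.1 (Nat.le_succ s)) fun h => hne ?_
      simp [h]
  have hR : q ^ (-c s) * (descSumPred q N c (s + 1) - descSumPred q N c s)
      = ∑ l ∈ descendingWithSum N with (s = 0 ∨ l s < l (s - 1)),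
        q ^ (-c s) * (q ^ (sumSq l - pairing c l + l s) / pochProd q l
          * (if s = 0 then 1 else 1 - q ^ (l (s - 1) - l s))) := by
    rw [Finset.sum_filter_of_ne, ← Finset.mul_sum]
    · congr 1
      rw [descSumPred_succ, descSumPred, descSum]
      split_ifs with h0
      · rw [sub_zero]
        refine Finset.sum_congr rfl fun l hl => ?_
        obtain ⟨hl, -⟩ := mem_descendingWithSum.mp hl
        rw [pairing_sub_single c hl, mul_one]
        congr 2
        ring
      · rw [descSum, ← Finset.sum_sub_distrib]
        refine Finset.sum_congr rfl fun l hl => ?_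
        obtain ⟨hl, -⟩ := mem_descendingWithSum.mp hl
        have hle := hl.1 (Nat.sub_le s 1)
        have e : sumSq l - (pairing c l - l (s - 1))
            = sumSq l - pairing c l + l s + ((l (s - 1) - l s : ℕ) : ℤ) := by
          push_cast [hle]
          ring
        rw [pairing_sub_single c hl, pairing_sub_single c hl, e, zpow_add₀ hq0 _ ((_ : ℕ) : ℤ),
          zpow_natCast, ← sub_add]
        ring
    · intro l hl hne
      obtain ⟨hl, -⟩ := mem_descendingWithSum.mp hl
      by_contra hcon
      push Not at hcon
      have h1 := hl.1 (Nat.sub_le s 1)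
      refine hne ?_
      simp [hcon.1, show l (s - 1) - l s = 0 by omega]
  rw [hL, hR]
  refine Finset.sum_nbij' (fun l => l - Pi.single s 1) (fun l => l + Pi.single s 1) ?_ ?_ ?_ ?_ ?_
  · intro l hl
    simp only [Finset.mem_filter, mem_descendingWithSum] at hl ⊢
    obtain ⟨⟨hl, hN⟩, hs⟩ := hl
    have hd := hl.unbump hs
    have hsum := sum_bump (s := s) hd
    rw [unbump_add_single hs, hN] at hsum
    refine ⟨⟨hd, by omega⟩, ?_⟩
    rcases s with _ | s
    · exact Or.inl rfl
    · right
      have := hl.1 (Nat.le_succ s)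
      simp at this ⊢
      omega
  · intro l hl
    simp only [Finset.mem_filter, mem_descendingWithSum] at hl ⊢
    obtain ⟨⟨hl, hN⟩, hs⟩ := hl
    refine ⟨⟨hl.bump hs, by rw [sum_bump hl, hN]⟩, ?_⟩
    have := hl.1 (Nat.le_succ s)
    simp at this ⊢
    omega
  · intro l hl
    exact unbump_add_single (Finset.mem_filter.mp hl).2
  · intro l _
    funext t
    simp
  · intro l hl
    simp only [Finset.mem_filter, mem_descendingWithSum] at hl
    obtain ⟨⟨hl, hN⟩, hs⟩ := hl
    have hd := hl.unbump hs
    have hs' : s = 0 ∨ (l - Pi.single s 1 : ℕ → ℕ) s < (l - Pi.single s 1 : ℕ → ℕ) (s - 1) := by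
      rcases s with _ | s
      · exact Or.inl rfl
      · right
        have := hl.1 (Nat.le_succ s)
        simp at this ⊢
        omega
    rw [← descSum_bump_term hq0 hq c hd hs', unbump_add_single hs]

theorem descSum_tail (hq0 : q ≠ 0) (hq : ∀ n : ℕ, q ^ (n + 1) ≠ 1) (N : ℕ) {c : ℕ → ℤ} {a : ℕ}
    (hc : ∀ s ≥ a, c s = 0) :
    descSum q (N + 1) (c + Pi.single a 1) - descSum q (N + 1) c
      = descSum q N c - descSumPred q N c a := by
  have htel : ∀ k, descSum q (N + 1) (c + Pi.single a 1)
        - descSum q (N + 1) (c + Pi.single (a + k) 1)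
      = descSumPred q N c (a + k) - descSumPred q N c a := by
    intro k
    induction k with
    | zero => simp
    | succ k ih =>
      have := descSum_step hq0 hq N c (a + k)
      rw [hc (a + k) (by omega), neg_zero, zpow_zero, one_mul] at this
      rw [← add_assoc]
      linear_combination ih + this
  have h := htel (N + 1)
  have e1 : descSum q (N + 1) (c + Pi.single (a + (N + 1)) 1) = descSum q (N + 1) c :=
    descSum_congr q fun t ht => by
      have : t ≠ a + (N + 1) := by omega
      simp [this]
  have e2 : descSumPred q N c (a + (N + 1)) = descSum q N c := by
    rw [← add_assoc, descSumPred_succ]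
    exact descSum_congr q fun t ht => by
      have : t ≠ a + N := by omega
      simp [this]
  rwa [e1, e2] at h

/-- The recurrence lowering the last nonzero entry `T` of the exponent sequence `c + δ_T`. -/
theorem descSum_lower (hq0 : q ≠ 0) (hq : ∀ n : ℕ, q ^ (n + 1) ≠ 1) (N : ℕ) {c : ℕ → ℤ} {T : ℕ}
    (hc : ∀ s > T, c s = 0) :
    descSum q (N + 1) (c + Pi.single T 1)
      = descSum q (N + 1) c + descSum q N c + (q ^ (-c T) - 1) * descSum q N (c - Pi.single T 1)
        - q ^ (-c T) * descSumPred q N c T := by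
  have h1 := descSum_step hq0 hq N c T
  have h2 := descSum_tail hq0 hq N (a := T + 1) (c := c) fun s hs => hc s hs
  rw [descSumPred_succ] at h1 h2
  linear_combination h1 + h2

theorem descSum_zero_right (hq0 : q ≠ 0) (hq : ∀ n : ℕ, q ^ (n + 1) ≠ 1) (N : ℕ) :
    descSum q N 0 = q ^ N / qPoch q N := by
  have hfull : ∀ N, descSum q N (fun t => if t < N then 1 else 0)
      = q ^ (-(N : ℤ)) * descSum q N 0 := fun N => by
    rw [descSum, descSum, Finset.mul_sum]
    refine Finset.sum_congr rfl fun l hl => ?_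
    obtain ⟨hl, hN⟩ := mem_descendingWithSum.mp hl
    have hz : ∀ t ≥ N, l t = 0 := fun t ht => hl.eq_zero_of_sum_le hN.le ht
    have e : pairing (fun t => if t < N then 1 else 0) l = N := by
      rw [finsum_eq_sum_range hz] at hN
      have hN' : ∑ t ∈ Finset.range N, (l t : ℤ) = N := by exact_mod_cast hN
      rw [pairing_eq_range _ hz, ← hN']
      exact Finset.sum_congr rfl fun t ht => by simp [Finset.mem_range.mp ht]
    rw [e, pairing_zero, ← mul_div_assoc, ← zpow_add₀ hq0]
    congr 2
    ring
  have hrec : ∀ N, descSum q (N + 1) 0 * (1 - q ^ (N + 1)) = q * descSum q N 0 := fun N => by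
    have htel : ∀ a, descSum q (N + 1) (fun t => if t < a then 1 else 0) - descSum q (N + 1) 0
        = if a = 0 then 0 else descSum q N (fun t => if t < a - 1 then 1 else 0) := by
      intro a
      induction a with
      | zero => simp [show (fun _ : ℕ => (0 : ℤ)) = 0 from rfl]
      | succ a ih =>
        have h := descSum_tail hq0 hq N (c := fun t => if t < a then 1 else 0) (a := a)
          fun s hs => by simp [hs]
        have e1 : (fun t => if t < a then 1 else 0) + Pi.single a 1
            = (fun t => if t < a + 1 then 1 else 0 : ℕ → ℤ) := by
          funext t
          rcases lt_trichotomy t a with ht | ht | ht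
          · simp [ht, ht.ne, ht.le]
          · simp [ht]
          · simp [ht.ne', ht.not_gt, show ¬ t < a + 1 by omega]
        rw [e1] at h
        have e2 : descSumPred q N (fun t => if t < a then 1 else 0) a
            = if a = 0 then 0 else descSum q N (fun t => if t < a - 1 then 1 else 0) := by
          rw [descSumPred]
          split_ifs with ha
          · rfl
          · congr 1
            funext t
            by_cases ht : t = a - 1
            · subst ht
              simp [show a - 1 < a by omega]
            · have : t < a ↔ t < a - 1 := by omega
              simp [ht, this]
        rw [e2] at h
        simp only [Nat.add_eq_zero_iff, one_ne_zero, and_false, if_false, Nat.add_sub_cancel]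
        linear_combination h + ih
    have h := htel (N + 1)
    rw [hfull, if_neg (Nat.succ_ne_zero N), Nat.add_sub_cancel, hfull, zpow_neg, zpow_neg,
      zpow_natCast, zpow_natCast] at h
    have h0 : q ^ N ≠ 0 := pow_ne_zero N hq0
    rw [pow_succ] at h ⊢
    field_simp at h
    linear_combination h
  induction N with
  | zero => simp [descSum_zero_left, qPoch]
  | succ N ih =>
    have h := hrec N
    have h1 : (1 - q ^ (N + 1)) ≠ 0 := sub_ne_zero.mpr (hq N).symm
    have h2 := qPoch_ne_zero hq N
    rw [ih] at h
    rw [qPoch_succ, eq_div_iff (mul_ne_zero h2 h1)]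
    field_simp at h
    linear_combination h

end recurrence

/-- A power series that is a polynomial of degree at most `D` whose coefficients satisfy
`f_n = f_{D - n}`. -/
def IsPalindromic {R : Type*} [CommRing R] (D : ℕ) (f : PowerSeries R) : Prop :=
  (∀ n m, n + m = D → PowerSeries.coeff n f = PowerSeries.coeff m f)
    ∧ ∀ n, D < n → PowerSeries.coeff n f = 0

namespace IsPalindromic

variable {R : Type*} [CommRing R] {D : ℕ} {f g : PowerSeries R}

theorem zero : IsPalindromic D (0 : PowerSeries R) := ⟨by simp, by simp⟩

theorem one : IsPalindromic 0 (1 : PowerSeries R) := by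
  refine ⟨fun n m h => ?_, fun n hn => ?_⟩
  · obtain ⟨rfl, rfl⟩ : n = 0 ∧ m = 0 := by omega
    rfl
  · simp [PowerSeries.coeff_one, hn.ne']

theorem add (hf : IsPalindromic D f) (hg : IsPalindromic D g) : IsPalindromic D (f + g) :=
  ⟨fun n m h => by simp [hf.1 n m h, hg.1 n m h], fun n h => by simp [hf.2 n h, hg.2 n h]⟩

theorem C_mul (a : R) (hf : IsPalindromic D f) : IsPalindromic D (PowerSeries.C a * f) :=
  ⟨fun n m h => by simp [hf.1 n m h], fun n h => by simp [hf.2 n h]⟩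

theorem X_mul (hf : IsPalindromic D f) : IsPalindromic (D + 2) (PowerSeries.X * f) := by
  refine ⟨fun n m h => ?_, fun n h => ?_⟩
  · rcases n with _ | n <;> rcases m with _ | m
    · rfl
    · rw [PowerSeries.coeff_succ_X_mul, hf.2 m (by omega)]
      simp
    · rw [PowerSeries.coeff_succ_X_mul, hf.2 n (by omega)]
      simp
    · rw [PowerSeries.coeff_succ_X_mul, PowerSeries.coeff_succ_X_mul, hf.1 n m (by omega)]
  · obtain ⟨n, rfl⟩ : ∃ k, n = k + 1 := ⟨n - 1, by omega⟩
    rw [PowerSeries.coeff_succ_X_mul, hf.2 n (by omega)]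

theorem one_add_X_mul (hf : IsPalindromic D f) :
    IsPalindromic (D + 1) ((1 + PowerSeries.X) * f) := by
  rw [add_mul, one_mul]
  refine ⟨fun n m h => ?_, fun n h => ?_⟩
  · rcases n with _ | n <;> rcases m with _ | m
    · rfl
    · simp only [map_add, PowerSeries.coeff_succ_X_mul, PowerSeries.coeff_zero_X_mul]
      rw [hf.2 (m + 1) (by omega), hf.1 0 m (by omega)]
      ring
    · simp only [map_add, PowerSeries.coeff_succ_X_mul, PowerSeries.coeff_zero_X_mul]
      rw [hf.2 (n + 1) (by omega), hf.1 n 0 (by omega)]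
      ring
    · simp only [map_add, PowerSeries.coeff_succ_X_mul]
      rw [hf.1 (n + 1) m (by omega), hf.1 n (m + 1) (by omega)]
      ring
  · obtain ⟨n, rfl⟩ : ∃ k, n = k + 1 := ⟨n - 1, by omega⟩
    simp only [map_add, PowerSeries.coeff_succ_X_mul]
    rw [hf.2 n (by omega), hf.2 (n + 1) (by omega), add_zero]

end IsPalindromic

section palindromic

variable {K : Type*} [Field K] {q : K}

/-- The generating series of `descSum q N c` in `N`. -/
noncomputable def descSeries (q : K) (c : ℕ → ℤ) : PowerSeries K :=
  PowerSeries.mk fun N => descSum q N c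

theorem constantCoeff_descSeries (q : K) (c : ℕ → ℤ) :
    PowerSeries.constantCoeff (descSeries q c) = 1 := by
  rw [← PowerSeries.coeff_zero_eq_constantCoeff_apply, descSeries, PowerSeries.coeff_mk,
    descSum_zero_left]

theorem descSeries_mul_inv (q : K) : descSeries q 0 * (descSeries q 0)⁻¹ = 1 :=
  PowerSeries.mul_inv_cancel _ (by rw [constantCoeff_descSeries]; exact one_ne_zero)

theorem descSeries_lower (hq0 : q ≠ 0) (hq : ∀ n : ℕ, q ^ (n + 1) ≠ 1) {c : ℕ → ℤ} {T : ℕ}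
    (hc : ∀ s > T, c s = 0) :
    descSeries q (c + Pi.single T 1)
      = (1 + PowerSeries.X) * descSeries q c
        + PowerSeries.C (q ^ (-c T) - 1) * (PowerSeries.X * descSeries q (c - Pi.single T 1))
        + PowerSeries.C (-q ^ (-c T)) * (PowerSeries.X *
          if T = 0 then 0 else descSeries q (c - Pi.single (T - 1) 1)) := by
  ext N
  rcases N with _ | N
  · generalize (if T = 0 then 0 else descSeries q (c - Pi.single (T - 1) 1)) = Z
    simp [descSeries, descSum_zero_left, add_mul]
  · simp only [map_add, PowerSeries.coeff_C_mul, PowerSeries.coeff_succ_X_mul, add_mul, one_mul]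
    have e : PowerSeries.coeff N (if T = 0 then 0 else descSeries q (c - Pi.single (T - 1) 1))
        = descSumPred q N c T := by
      rw [descSumPred]
      split_ifs <;> simp [descSeries]
    rw [e]
    simp only [descSeries, PowerSeries.coeff_mk]
    rw [descSum_lower hq0 hq N hc]
    ring

theorem natCast_sub_single {l : ℕ → ℕ} {s : ℕ} (hs : 0 < l s) :
    (fun t => (((l - Pi.single s 1 : ℕ → ℕ) t : ℕ) : ℤ))
      = (fun t => (l t : ℤ)) - Pi.single s 1 := by
  funext t
  by_cases h : t = s
  · subst h
    simp
    omega
  · simp [h]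

theorem sum_unbump {l : ℕ → ℕ} {s : ℕ} (hl : IsDescending l) (hs : l (s + 1) < l s) :
    ∑ᶠ t, (l - Pi.single s 1 : ℕ → ℕ) t + 1 = ∑ᶠ t, l t := by
  rw [← sum_bump (s := s) (hl.unbump hs), unbump_add_single hs]

theorem IsDescending.exists_last {l : ℕ → ℕ} (hl : IsDescending l) (h0 : l ≠ 0) :
    ∃ T, 0 < l T ∧ ∀ s > T, l s = 0 := by
  classical
  obtain ⟨L, hL⟩ := hl.2
  have hex : ∃ t, l t = 0 := ⟨L, hL L le_rfl⟩
  have hpos : Nat.find hex ≠ 0 := fun h => h0 <| funext fun t => by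
    have h1 := Nat.find_spec hex
    rw [h] at h1
    have := hl.1 (Nat.zero_le t)
    simp only [Pi.zero_apply]
    omega
  refine ⟨Nat.find hex - 1, Nat.pos_of_ne_zero (Nat.find_min hex (by omega)), fun s hs => ?_⟩
  have h1 := Nat.find_spec hex
  have := hl.1 (show Nat.find hex ≤ s by omega)
  omega

theorem isPalindromic_descSeries (hq0 : q ≠ 0) (hq : ∀ n : ℕ, q ^ (n + 1) ≠ 1) {l : ℕ → ℕ}
    (hl : IsDescending l) :
    IsPalindromic (∑ᶠ t, l t) ((descSeries q 0)⁻¹ * descSeries q (fun t => (l t : ℤ))) := by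
  induction hN : ∑ᶠ t, l t using Nat.strong_induction_on generalizing l with
  | _ N ih =>
  by_cases h0 : l = 0
  · subst h0
    have e : (fun t : ℕ => (((0 : ℕ → ℕ) t : ℕ) : ℤ)) = 0 := by
      funext t
      simp
    rw [e, mul_comm, descSeries_mul_inv, ← hN]
    simpa using IsPalindromic.one
  obtain ⟨T, hT, hT'⟩ := hl.exists_last h0
  have hT1 : l (T + 1) < l T := by rw [hT' (T + 1) (by omega)]; exact hT
  set m : ℕ → ℕ := l - Pi.single T 1 with hm
  have hmd : IsDescending m := hl.unbump hT1
  have hmsum := sum_unbump hl hT1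
  rw [← hm, hN] at hmsum
  have hmc := natCast_sub_single hT
  rw [← hm] at hmc
  have hmT : m T = l T - 1 := by simp [hm]
  have hlc : (fun t => (l t : ℤ)) = (fun t => (m t : ℤ)) + Pi.single T 1 := by
    rw [hmc, sub_add_cancel]
  have hmz : ∀ s > T, (m s : ℤ) = 0 := fun s hs => by simp [hm, hT' s hs]
  rw [hlc, descSeries_lower hq0 hq hmz]
  simp only [mul_add, mul_left_comm (descSeries q 0)⁻¹]
  refine IsPalindromic.add (IsPalindromic.add ?_ ?_) ?_
  · rw [← hmsum]
    exact (ih _ (by omega) hmd rfl).one_add_X_mul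
  · by_cases h1 : l T = 1
    · simpa [hmT, h1] using IsPalindromic.zero
    · have hmT1 : m (T + 1) < m T := by
        rw [hmT]
        simp [hm, hT' (T + 1) (by omega)]
        omega
      have hs := sum_unbump hmd hmT1
      rw [← natCast_sub_single (by omega),
        show N = ∑ᶠ t, (m - Pi.single T 1 : ℕ → ℕ) t + 2 by omega]
      exact ((ih _ (by omega) (hmd.unbump hmT1) rfl).X_mul).C_mul _
  · rcases T with _ | T
    · simpa using IsPalindromic.zero
    · have hlt : m (T + 1) < m T := by
        have h1 := hl.1 (Nat.le_succ T)
        simp [hm] at h1 ⊢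
        omega
      have hs := sum_unbump hmd hlt
      simp only [Nat.add_eq_zero_iff, one_ne_zero, and_false, if_false, Nat.add_sub_cancel]
      rw [← natCast_sub_single (by omega),
        show N = ∑ᶠ t, (m - Pi.single T 1 : ℕ → ℕ) t + 2 by omega]
      exact ((ih _ (by omega) (hmd.unbump hlt) rfl).X_mul).C_mul _

end palindromic

section monomialSubst

variable {ι R : Type*} [CommRing R]

/-- The substitution of the monomial `y^c` into a power series in one variable. -/
noncomputable def monomialSubst (c : ι →₀ ℕ) (f : PowerSeries R) : MvPowerSeries ι R :=
  PowerSeries.subst (monomial c (1 : R)) f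

variable {c : ι →₀ ℕ}

theorem monomialSubst_mul (hc : c ≠ 0) (f g : PowerSeries R) :
    monomialSubst c (f * g) = monomialSubst c f * monomialSubst c g :=
  PowerSeries.subst_mul (PowerSeries.HasSubst.monomial hc 1) f g

theorem monomialSubst_add (hc : c ≠ 0) (f g : PowerSeries R) :
    monomialSubst c (f + g) = monomialSubst c f + monomialSubst c g :=
  PowerSeries.subst_add (PowerSeries.HasSubst.monomial hc 1) f g

theorem coeff_monomialSubst (hc : c ≠ 0) (f : PowerSeries R) (e : ι →₀ ℕ) [DecidableEq ι] :
    coeff e (monomialSubst c f) = ∑ᶠ k : ℕ, if e = k • c then PowerSeries.coeff k f else 0 := by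
  rw [monomialSubst, PowerSeries.coeff_subst (PowerSeries.HasSubst.monomial hc 1)]
  refine finsum_congr fun k => ?_
  rw [monomial_pow, one_pow, coeff_monomial]
  split_ifs <;> simp

theorem smul_finsupp_injective (hc : c ≠ 0) : Function.Injective fun k : ℕ => k • c := by
  obtain ⟨i, hi⟩ := Finsupp.ne_iff.mp hc
  intro a b h
  exact Nat.eq_of_mul_eq_mul_right (Nat.pos_of_ne_zero hi) (DFunLike.congr_fun h i)

theorem coeff_smul_monomialSubst (hc : c ≠ 0) (f : PowerSeries R) (k : ℕ) :
    coeff (k • c) (monomialSubst c f) = PowerSeries.coeff k f := by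
  classical
  rw [coeff_monomialSubst hc, finsum_eq_single _ k]
  · simp
  · intro m hm
    exact if_neg fun h => hm (smul_finsupp_injective hc h).symm

theorem exists_smul_of_coeff_monomialSubst_ne_zero (hc : c ≠ 0) {f : PowerSeries R}
    {e : ι →₀ ℕ} (h : coeff e (monomialSubst c f) ≠ 0) : ∃ k : ℕ, e = k • c := by
  classical
  by_contra hcon
  push Not at hcon
  refine h ?_
  rw [coeff_monomialSubst hc]
  simp [hcon]

theorem monomialSubst_C (hc : c ≠ 0) (a : R) : monomialSubst c (PowerSeries.C a) = C a := by
  rw [monomialSubst, ← PowerSeries.coe_substAlgHom (PowerSeries.HasSubst.monomial hc 1)]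
  exact AlgHom.commutes _ a

theorem monomialSubst_one (hc : c ≠ 0) : monomialSubst c (1 : PowerSeries R) = 1 := by
  simpa using monomialSubst_C hc (1 : R)

theorem monomialSubst_X (hc : c ≠ 0) :
    monomialSubst c (PowerSeries.X : PowerSeries R) = monomial c 1 :=
  PowerSeries.subst_X (PowerSeries.HasSubst.monomial hc 1)

theorem coeff_monomialSubst_single_mul [DecidableEq ι] (i : ι) (f : PowerSeries R)
    (F : MvPowerSeries ι R) (d : ι →₀ ℕ) :
    coeff d (monomialSubst (Finsupp.single i 1) f * F)
      = ∑ p ∈ Finset.HasAntidiagonal.antidiagonal (d i),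
        PowerSeries.coeff p.1 f * coeff (d.update i p.2) F := by
  have hc : Finsupp.single i 1 ≠ 0 := by simp
  rw [coeff_mul]
  symm
  refine Finset.sum_of_injOn (fun p => (Finsupp.single i p.1, d.update i p.2)) ?_ ?_ ?_ ?_
  · rintro ⟨a, b⟩ - ⟨a', b'⟩ - h
    simp only [Prod.mk.injEq] at h
    have h1 := DFunLike.congr_fun h.1 i
    have h2 := DFunLike.congr_fun h.2 i
    simp at h1 h2
    simp [h1, h2]
  · rintro ⟨a, b⟩ h
    simp only [Finset.mem_coe, Finset.HasAntidiagonal.mem_antidiagonal] at h ⊢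
    ext j
    by_cases hj : j = i
    · subst hj
      simpa using h
    · simp [hj]
  · rintro ⟨u, v⟩ huv hn
    simp only [Finset.HasAntidiagonal.mem_antidiagonal] at huv
    by_contra hne
    obtain ⟨k, hk⟩ := exists_smul_of_coeff_monomialSubst_ne_zero hc (left_ne_zero_of_mul hne)
    replace hk : u = k • Finsupp.single i 1 := hk
    refine hn ⟨(k, v i), ?_, ?_⟩
    · rw [Finset.mem_coe, Finset.HasAntidiagonal.mem_antidiagonal, ← huv, hk]
      simp
    · have hu : u = Finsupp.single i k := by rw [hk]; simp
      simp only [Prod.mk.injEq]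
      refine ⟨hu.symm, ?_⟩
      rw [← huv, hu]
      ext j
      by_cases hj : j = i
      · subst hj
        simp
      · simp [Finsupp.update_apply, hj]
  · rintro ⟨a, b⟩ -
    have := coeff_smul_monomialSubst hc f a
    simp only [Finsupp.smul_single, smul_eq_mul, mul_one] at this
    simp [this]

end monomialSubst

section reflection

variable {ι R : Type*} [Fintype ι] [CommRing R] {adj : ι → ι → ℕ} {i : ι}

/-- `b` is the image of `a` under the simple reflection at `i` of the graph with adjacency
matrix `adj`. -/
def IsReflection (adj : ι → ι → ℕ) (i : ι) (a b : ι →₀ ℕ) : Prop :=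
  (∀ j, j ≠ i → a j = b j) ∧ a i + b i = ∑ j, adj i j * a j

namespace IsReflection

variable {a b a' b' : ι →₀ ℕ}

theorem symm (hadj : adj i i = 0) (h : IsReflection adj i a b) : IsReflection adj i b a := by
  refine ⟨fun j hj => (h.1 j hj).symm, ?_⟩
  rw [add_comm, h.2]
  refine Finset.sum_congr rfl fun j _ => ?_
  by_cases hj : j = i
  · subst hj
    simp [hadj]
  · rw [h.1 j hj]

theorem eq (h : IsReflection adj i a b) (h' : IsReflection adj i a b') : b = b' := by
  ext j
  by_cases hj : j = i
  · subst hj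
    have := h.2
    have := h'.2
    omega
  · rw [← h.1 j hj, ← h'.1 j hj]

theorem add (h : IsReflection adj i a b) (h' : IsReflection adj i a' b') :
    IsReflection adj i (a + a') (b + b') := by
  refine ⟨fun j hj => by simp [h.1 j hj, h'.1 j hj], ?_⟩
  have h1 := h.2
  have h2 := h'.2
  simp only [Finsupp.add_apply, mul_add, Finset.sum_add_distrib]
  omega

theorem smul (k : ℕ) (h : IsReflection adj i a b) : IsReflection adj i (k • a) (k • b) := by
  refine ⟨fun j hj => by simp [h.1 j hj], ?_⟩
  have h1 := h.2
  simp only [Finsupp.smul_apply, smul_eq_mul, ← mul_add, h1, Finset.mul_sum]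
  exact Finset.sum_congr rfl fun j _ => by ring

end IsReflection

/-- The simple reflection at `i` matches the coefficients of `F` with those of `G`. -/
structure ReflectsTo (adj : ι → ι → ℕ) (i : ι) (F G : MvPowerSeries ι R) : Prop where
  coeff_eq : ∀ a b, IsReflection adj i a b → coeff a F = coeff b G
  left : ∀ a, coeff a F ≠ 0 → ∃ b, IsReflection adj i a b
  right : ∀ a, coeff a G ≠ 0 → ∃ b, IsReflection adj i a b

namespace ReflectsTo

variable {F G F' G' : MvPowerSeries ι R}

theorem one (hadj : adj i i = 0) :
    ReflectsTo adj i (1 : MvPowerSeries ι R) (1 : MvPowerSeries ι R) := by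
  classical
  have h0 : IsReflection adj i 0 0 := ⟨by simp, by simp⟩
  have key : ∀ a, coeff a (1 : MvPowerSeries ι R) ≠ 0 → a = 0 := fun a ha => by
    by_contra hn
    exact ha (by rw [coeff_one, if_neg hn])
  refine ⟨fun a b h => ?_, fun a ha => ⟨0, key a ha ▸ h0⟩, fun a ha => ⟨0, key a ha ▸ h0⟩⟩
  have : a = 0 ↔ b = 0 := by
    constructor
    · rintro rfl
      exact h.eq h0
    · rintro rfl
      exact (h.symm hadj).eq h0
  simp [coeff_one, this]

theorem mul (hadj : adj i i = 0) (h : ReflectsTo adj i F G) (h' : ReflectsTo adj i F' G') :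
    ReflectsTo adj i (F * F') (G * G') := by
  classical
  have hex : ∀ {A B : MvPowerSeries ι R}, (∀ a, coeff a A ≠ 0 → ∃ b, IsReflection adj i a b) →
      (∀ a, coeff a B ≠ 0 → ∃ b, IsReflection adj i a b) →
      ∀ a, coeff a (A * B) ≠ 0 → ∃ b, IsReflection adj i a b := by
    intro A B hA hB a ha
    rw [coeff_mul] at ha
    obtain ⟨⟨u, v⟩, huv, hne⟩ := Finset.exists_ne_zero_of_sum_ne_zero ha
    obtain ⟨u', hu⟩ := hA u (left_ne_zero_of_mul hne)
    obtain ⟨v', hv⟩ := hB v (right_ne_zero_of_mul hne)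
    exact ⟨u' + v', Finset.HasAntidiagonal.mem_antidiagonal.mp huv ▸ hu.add hv⟩
  refine ⟨fun a b hab => ?_, hex h.left h'.left, hex h.right h'.right⟩
  rw [coeff_mul, coeff_mul]
  refine Finset.sum_bij_ne_zero
    (fun p _ hp => ((h.left p.1 (left_ne_zero_of_mul hp)).choose,
      (h'.left p.2 (right_ne_zero_of_mul hp)).choose)) ?_ ?_ ?_ ?_
  · intro p hp hne
    have h1 := (h.left p.1 (left_ne_zero_of_mul hne)).choose_spec
    have h2 := (h'.left p.2 (right_ne_zero_of_mul hne)).choose_spec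
    rw [Finset.HasAntidiagonal.mem_antidiagonal] at hp ⊢
    have h3 := h1.add h2
    rw [hp] at h3
    exact h3.eq hab
  · intro p _ hne p' _ hne' heq
    have h1 := (h.left p.1 (left_ne_zero_of_mul hne)).choose_spec
    have h2 := (h'.left p.2 (right_ne_zero_of_mul hne)).choose_spec
    have h1' := (h.left p'.1 (left_ne_zero_of_mul hne')).choose_spec
    have h2' := (h'.left p'.2 (right_ne_zero_of_mul hne')).choose_spec
    simp only [Prod.mk.injEq] at heq
    rw [heq.1] at h1
    rw [heq.2] at h2
    exact Prod.ext ((h1.symm hadj).eq (h1'.symm hadj)) ((h2.symm hadj).eq (h2'.symm hadj))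
  · intro p hp hne
    obtain ⟨u, hu⟩ := h.right p.1 (left_ne_zero_of_mul hne)
    obtain ⟨v, hv⟩ := h'.right p.2 (right_ne_zero_of_mul hne)
    have hu' := h.coeff_eq _ _ (hu.symm hadj)
    have hv' := h'.coeff_eq _ _ (hv.symm hadj)
    have hne' : coeff u F * coeff v F' ≠ 0 := by rwa [hu', hv']
    refine ⟨(u, v), ?_, hne', ?_⟩
    · rw [Finset.HasAntidiagonal.mem_antidiagonal] at hp ⊢
      have h3 := hu.add hv
      rw [hp] at h3
      exact h3.eq (hab.symm hadj)
    · have h1 := (h.left u (left_ne_zero_of_mul hne')).choose_spec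
      have h2 := (h'.left v (right_ne_zero_of_mul hne')).choose_spec
      exact Prod.ext (h1.eq (hu.symm hadj)) (h2.eq (hv.symm hadj))
  · intro p _ hne
    have h1 := (h.left p.1 (left_ne_zero_of_mul hne)).choose_spec
    have h2 := (h'.left p.2 (right_ne_zero_of_mul hne)).choose_spec
    exact congrArg₂ (· * ·) (h.coeff_eq _ _ h1) (h'.coeff_eq _ _ h2)

theorem prod (hadj : adj i i = 0) {κ : Type*} (s : Finset κ) (f g : κ → MvPowerSeries ι R)
    (h : ∀ k ∈ s, ReflectsTo adj i (f k) (g k)) :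
    ReflectsTo adj i (∏ k ∈ s, f k) (∏ k ∈ s, g k) := by
  classical
  induction s using Finset.induction_on with
  | empty => simpa using one hadj
  | insert a s ha ih =>
    rw [Finset.prod_insert ha, Finset.prod_insert ha]
    exact (h a (by simp)).mul hadj (ih fun k hk => h k (by simp [hk]))

theorem monomialSubst (hadj : adj i i = 0) {a b : ι →₀ ℕ} (ha : a ≠ 0) (hb : b ≠ 0)
    (h : IsReflection adj i a b) (f : PowerSeries R) :
    ReflectsTo adj i (monomialSubst a f) (monomialSubst b f) := by
  have hside : ∀ {a b : ι →₀ ℕ}, a ≠ 0 → IsReflection adj i a b →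
      ∀ e, coeff e (_root_.monomialSubst a f) ≠ 0 → ∃ b, IsReflection adj i e b := by
    intro a b ha h e he
    obtain ⟨k, rfl⟩ := exists_smul_of_coeff_monomialSubst_ne_zero ha he
    exact ⟨k • b, h.smul k⟩
  refine ⟨fun u v huv => ?_, hside ha h, hside hb (h.symm hadj)⟩
  by_cases hk : ∃ k : ℕ, u = k • a
  · obtain ⟨k, rfl⟩ := hk
    rw [huv.eq (h.smul k), coeff_smul_monomialSubst ha, coeff_smul_monomialSubst hb]
  · have hk' : ¬ ∃ k : ℕ, v = k • b := by
      rintro ⟨k, rfl⟩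
      exact hk ⟨k, (huv.symm hadj).eq ((h.symm hadj).smul k)⟩
    rw [not_not.mp (mt (exists_smul_of_coeff_monomialSubst_ne_zero ha) hk),
      not_not.mp (mt (exists_smul_of_coeff_monomialSubst_ne_zero hb) hk')]

end ReflectsTo

/-- A series invariant under all simple reflections of a finite-type graph is constant. -/
theorem coeff_eq_zero_of_reflectsTo_self (hadj : ∀ i, adj i i = 0)
    (hpos : ∀ d : ι →₀ ℕ, d ≠ 0 → ∃ i, ∑ j, adj i j * d j < 2 * d i)
    {G : MvPowerSeries ι R} (hG : ∀ i, ReflectsTo adj i G G) {d : ι →₀ ℕ} (hd : d ≠ 0) :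
    coeff d G = 0 := by
  induction hn : ∑ j, d j using Nat.strong_induction_on generalizing d with
  | _ n ih =>
  obtain ⟨i, hi⟩ := hpos d hd
  by_contra hne
  obtain ⟨b, hb⟩ := (hG i).left d hne
  have hb0 : b ≠ 0 := by
    rintro rfl
    exact hd ((hb.symm (hadj i)).eq ⟨by simp, by simp⟩)
  refine hne ?_
  rw [(hG i).coeff_eq d b hb]
  refine ih _ ?_ hb0 rfl
  rw [← hn]
  refine Finset.sum_lt_sum (fun j _ => ?_) ⟨i, Finset.mem_univ i, ?_⟩
  · by_cases hj : j = i
    · subst hj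
      have := hb.2
      omega
    · exact (hb.1 j hj).symm.le
  · have := hb.2
    omega

end reflection

section tupleSeries

variable {ι K : Type*} [Fintype ι] [Field K] {q : K} {adj : ι → ι → ℕ}
  {W : (ι → ℕ → ℕ) → K}

/-- The sum of the sequences `r j` over the neighbours `j` of `i`. -/
def adjSum (adj : ι → ι → ℕ) (i : ι) (r : ι → ℕ → ℕ) : ℕ → ℕ := ∑ j, adj i j • r j

theorem IsDescending.adjSum (i : ι) {r : ι → ℕ → ℕ} (hr : ∀ j, IsDescending (r j)) :
    IsDescending (adjSum adj i r) :=
  IsDescending.sum _ _ fun j _ => (hr j).smul _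

theorem finsum_adjSum (i : ι) {r : ι → ℕ → ℕ} (hr : ∀ j, IsDescending (r j)) :
    ∑ᶠ t, adjSum adj i r t = ∑ j, adj i j * ∑ᶠ t, r j t := by
  choose N hN using fun j => (hr j).2
  simp only [adjSum, Finset.sum_apply, Pi.smul_apply, smul_eq_mul, mul_finsum]
  refine finsum_sum_comm _ _ fun j _ => ?_
  refine (Set.finite_lt_nat (N j)).subset fun t ht => ?_
  by_contra hlt
  exact ht (by simp [hN j t (not_lt.mp hlt)])

variable [DecidableEq ι]

/-- `W` is multiplicative in each entry of a tuple of descending sequences, the factor of the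
entry at `i` being the summand of `descSum` twisted by the neighbours of `i`. -/
structure IsTupleWeight (q : K) (adj : ι → ι → ℕ) (W : (ι → ℕ → ℕ) → K) : Prop where
  zero : W 0 = 1
  update : ∀ (r : ι → ℕ → ℕ) (i : ι) (l : ℕ → ℕ), (∀ j, IsDescending (r j)) → r i = 0 →
    IsDescending l → W (Function.update r i l)
      = W r * (q ^ (sumSq l - pairing (fun t => (adjSum adj i r t : ℤ)) l) / pochProd q l)

/-- The tuples of descending sequences with sums `d`. -/
noncomputable def tuplesWithSum (d : ι →₀ ℕ) : Finset (ι → ℕ → ℕ) :=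
  Fintype.piFinset fun i => descendingWithSum (d i)

theorem mem_tuplesWithSum {d : ι →₀ ℕ} {r : ι → ℕ → ℕ} :
    r ∈ tuplesWithSum d ↔ ∀ i, IsDescending (r i) ∧ ∑ᶠ t, r i t = d i := by
  simp [tuplesWithSum, mem_descendingWithSum]

/-- The generating series of the weights of tuples of descending sequences. -/
noncomputable def tupleSeries (W : (ι → ℕ → ℕ) → K) : MvPowerSeries ι K :=
  fun d => ∑ r ∈ tuplesWithSum d, W r

theorem coeff_tupleSeries (W : (ι → ℕ → ℕ) → K) (d : ι →₀ ℕ) :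
    coeff d (tupleSeries W) = ∑ r ∈ tuplesWithSum d, W r := rfl

theorem coeff_tupleSeries_split (hW : IsTupleWeight q adj W) (i : ι) (d : ι →₀ ℕ) :
    coeff d (tupleSeries W) = ∑ r ∈ tuplesWithSum (d.update i 0),
      W r * PowerSeries.coeff (d i) (descSeries q fun t => (adjSum adj i r t : ℤ)) := by
  simp only [coeff_tupleSeries, descSeries, PowerSeries.coeff_mk, descSum, Finset.mul_sum]
  rw [← Finset.sum_product']
  have hzero : ∀ r ∈ tuplesWithSum (d.update i 0), r i = 0 := fun r hr => by
    obtain ⟨h1, h2⟩ := mem_tuplesWithSum.mp hr i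
    have : r i ∈ descendingWithSum 0 := mem_descendingWithSum.mpr ⟨h1, by simpa using h2⟩
    simpa [descendingWithSum_zero] using this
  refine Finset.sum_nbij' (fun r => (Function.update r i 0, r i))
    (fun p => Function.update p.1 i p.2) ?_ ?_ ?_ ?_ ?_
  · intro r hr
    rw [mem_tuplesWithSum] at hr
    refine Finset.mem_product.mpr ⟨mem_tuplesWithSum.mpr fun j => ?_,
      mem_descendingWithSum.mpr (hr i)⟩
    by_cases hj : j = i
    · subst hj
      simp [IsDescending.zero]
    · simpa [hj, Finsupp.update_apply] using hr j
  · rintro ⟨r, l⟩ hp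
    obtain ⟨hr, hl⟩ := Finset.mem_product.mp hp
    rw [mem_tuplesWithSum] at hr ⊢
    intro j
    by_cases hj : j = i
    · subst hj
      simpa using mem_descendingWithSum.mp hl
    · simpa [hj, Finsupp.update_apply] using hr j
  · intro r _
    simp
  · rintro ⟨r, l⟩ hp
    obtain ⟨hr, hl⟩ := Finset.mem_product.mp hp
    have := hzero r hr
    simp [← this]
  · intro r hr
    rw [mem_tuplesWithSum] at hr
    have hdesc : ∀ j, IsDescending (Function.update r i 0 j) := fun j => by
      by_cases hj : j = i
      · subst hj
        simp [IsDescending.zero]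
      · simpa [hj] using (hr j).1
    rw [← hW.update _ i (r i) hdesc (by simp) (hr i).1]
    simp

/-- The factor of `tupleSeries W` that is symmetric under the reflection at `i`. -/
noncomputable def reducedSeries (q : K) (adj : ι → ι → ℕ) (W : (ι → ℕ → ℕ) → K) (i : ι) :
    MvPowerSeries ι K :=
  fun d => ∑ r ∈ tuplesWithSum (d.update i 0), W r * PowerSeries.coeff (d i)
    ((descSeries q 0)⁻¹ * descSeries q fun t => (adjSum adj i r t : ℤ))

theorem coeff_reducedSeries (i : ι) (d : ι →₀ ℕ) :
    coeff d (reducedSeries q adj W i)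
      = ∑ r ∈ tuplesWithSum (d.update i 0), W r * PowerSeries.coeff (d i)
        ((descSeries q 0)⁻¹ * descSeries q fun t => (adjSum adj i r t : ℤ)) := rfl

theorem tupleSeries_eq_mul_reducedSeries (hW : IsTupleWeight q adj W) (i : ι) :
    tupleSeries W
      = monomialSubst (Finsupp.single i 1) (descSeries q 0) * reducedSeries q adj W i := by
  ext d
  rw [coeff_tupleSeries_split hW i, coeff_monomialSubst_single_mul]
  have hupd : ∀ k, (d.update i k).update i 0 = d.update i 0 := fun k => by
    ext j
    by_cases hj : j = i <;> simp [Finsupp.update_apply, hj]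
  simp only [coeff_reducedSeries, hupd, Finset.mul_sum]
  rw [Finset.sum_comm]
  refine Finset.sum_congr rfl fun r _ => ?_
  have hfactor : (descSeries q fun t => (adjSum adj i r t : ℤ)) = descSeries q 0
      * ((descSeries q 0)⁻¹ * descSeries q fun t => (adjSum adj i r t : ℤ)) := by
    rw [← mul_assoc, descSeries_mul_inv, one_mul]
  conv_lhs => rw [hfactor, PowerSeries.coeff_mul, Finset.mul_sum]
  refine Finset.sum_congr rfl fun p _ => ?_
  simp only [Finsupp.update_apply, if_true]
  rw [mul_left_comm]

theorem reflectsTo_reducedSeries (hq0 : q ≠ 0) (hq : ∀ n : ℕ, q ^ (n + 1) ≠ 1)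
    {i : ι} (hadj : adj i i = 0) :
    ReflectsTo adj i (reducedSeries q adj W i) (reducedSeries q adj W i) := by
  have hpal : ∀ (a : ι →₀ ℕ), ∀ r ∈ tuplesWithSum (a.update i 0),
      IsPalindromic (∑ j, adj i j * a j)
        ((descSeries q 0)⁻¹ * descSeries q fun t => (adjSum adj i r t : ℤ)) := by
    intro a r hr
    rw [mem_tuplesWithSum] at hr
    have hdesc := fun j => (hr j).1
    have hsum : ∑ j, adj i j * a j = ∑ᶠ t, adjSum adj i r t := by
      rw [finsum_adjSum i hdesc]
      refine Finset.sum_congr rfl fun j _ => ?_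
      by_cases hj : j = i
      · subst hj
        simp [hadj]
      · rw [(hr j).2, Finsupp.update_apply, if_neg hj]
    rw [hsum]
    exact isPalindromic_descSeries hq0 hq (IsDescending.adjSum i hdesc)
  have hex : ∀ a, coeff a (reducedSeries q adj W i) ≠ 0 → ∃ b, IsReflection adj i a b := by
    intro a ha
    rw [coeff_reducedSeries] at ha
    obtain ⟨r, hr, hne⟩ := Finset.exists_ne_zero_of_sum_ne_zero ha
    have hle : a i ≤ ∑ j, adj i j * a j := by
      by_contra hlt
      exact right_ne_zero_of_mul hne ((hpal a r hr).2 _ (not_le.mp hlt))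
    refine ⟨a.update i (∑ j, adj i j * a j - a i), fun j hj => ?_, ?_⟩
    · simp [Finsupp.update_apply, hj]
    · simp [Finsupp.update_apply, hle]
  refine ⟨fun a b hab => ?_, hex, hex⟩
  have hupd : a.update i 0 = b.update i 0 := by
    ext j
    by_cases hj : j = i
    · simp [hj]
    · simpa [Finsupp.update_apply, hj] using hab.1 j hj
  rw [coeff_reducedSeries, coeff_reducedSeries, ← hupd]
  exact Finset.sum_congr rfl fun r hr => by rw [(hpal a r hr).1 _ _ hab.2]

/-- A generating series of tuples of descending sequences is the product, over a set of positive
roots stable under simple reflections, of the one-variable series `descSeries q 0`. -/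
theorem tupleSeries_eq_prod (hq0 : q ≠ 0) (hq : ∀ n : ℕ, q ^ (n + 1) ≠ 1)
    (hadj : ∀ i, adj i i = 0)
    (hpos : ∀ d : ι →₀ ℕ, d ≠ 0 → ∃ i, ∑ j, adj i j * d j < 2 * d i)
    (hW : IsTupleWeight q adj W) (Φ : Finset (ι →₀ ℕ)) (h0 : (0 : ι →₀ ℕ) ∉ Φ)
    (hsimple : ∀ i, Finsupp.single i 1 ∈ Φ)
    (hrefl : ∀ i, ∀ c ∈ Φ, c ≠ Finsupp.single i 1 → ∃ b ∈ Φ, IsReflection adj i c b) :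
    tupleSeries W = ∏ c ∈ Φ, monomialSubst c (descSeries q 0) := by
  have hne0 : ∀ c ∈ Φ, c ≠ 0 := fun c hc h => h0 (h ▸ hc)
  have hinv : ∀ c ∈ Φ, monomialSubst c (descSeries q 0) * monomialSubst c (descSeries q 0)⁻¹
      = 1 := fun c hc => by
    rw [← monomialSubst_mul (hne0 c hc), descSeries_mul_inv, monomialSubst_one (hne0 c hc)]
  set P : MvPowerSeries ι K := ∏ c ∈ Φ, monomialSubst c (descSeries q 0)⁻¹ with hP
  have hsplit : ∀ i, tupleSeries W * P = reducedSeries q adj W i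
      * ∏ c ∈ Φ.erase (Finsupp.single i 1), monomialSubst c (descSeries q 0)⁻¹ := fun i => by
    rw [hP, ← Finset.mul_prod_erase Φ _ (hsimple i), tupleSeries_eq_mul_reducedSeries hW i,
      ← mul_assoc, mul_right_comm (monomialSubst _ _), hinv _ (hsimple i), one_mul]
  have hinvariant : ∀ i, ReflectsTo adj i (tupleSeries W * P) (tupleSeries W * P) := by
    intro i
    rw [hsplit i]
    refine (reflectsTo_reducedSeries hq0 hq (hadj i)).mul (hadj i) ?_
    have hroot : ∀ c ∈ Φ.erase (Finsupp.single i 1), ∃ b ∈ Φ.erase (Finsupp.single i 1),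
        IsReflection adj i c b := by
      intro c hc
      obtain ⟨hcs, hcΦ⟩ := Finset.mem_erase.mp hc
      obtain ⟨b, hb, hcb⟩ := hrefl i c hcΦ hcs
      refine ⟨b, Finset.mem_erase.mpr ⟨?_, hb⟩, hcb⟩
      rintro rfl
      have h1 := hcb.2
      rw [Finset.sum_eq_zero] at h1
      · simp at h1
      · intro j _
        by_cases hj : j = i
        · simp [hj, hadj]
        · rw [hcb.1 j hj]
          simp [hj]
    choose! σ hσ hσr using hroot
    have hperm : ∏ c ∈ Φ.erase (Finsupp.single i 1), monomialSubst (σ c) (descSeries q 0)⁻¹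
        = ∏ c ∈ Φ.erase (Finsupp.single i 1), monomialSubst c (descSeries q 0)⁻¹ := by
      refine Finset.prod_nbij σ hσ ?_ ?_ fun _ _ => rfl
      · intro c hc c' hc' h
        have h1 := hσr c' hc'
        rw [← h] at h1
        exact ((hσr c hc).symm (hadj i)).eq (h1.symm (hadj i))
      · intro c hc
        exact ⟨σ c, hσ c hc, (hσr _ (hσ c hc)).eq ((hσr c hc).symm (hadj i))⟩
    have := ReflectsTo.prod (hadj i) (Φ.erase (Finsupp.single i 1))
      (fun c => monomialSubst c (descSeries q 0)⁻¹)
      (fun c => monomialSubst (σ c) (descSeries q 0)⁻¹) fun c hc =>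
        ReflectsTo.monomialSubst (hadj i) (hne0 c (Finset.mem_of_mem_erase hc))
          (hne0 _ (Finset.mem_of_mem_erase (hσ c hc))) (hσr c hc) _
    rwa [hperm] at this
  have hconst : ∀ c ∈ Φ, constantCoeff (monomialSubst c (descSeries q 0)⁻¹) = 1 := by
    intro c hc
    have := coeff_smul_monomialSubst (hne0 c hc) (descSeries q 0)⁻¹ 0
    rw [zero_smul, coeff_zero_eq_constantCoeff_apply] at this
    rw [this, PowerSeries.coeff_zero_eq_constantCoeff_apply, PowerSeries.constantCoeff_inv,
      constantCoeff_descSeries, inv_one]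
  have hone : tupleSeries W * P = 1 := by
    ext d
    by_cases hd : d = 0
    · subst hd
      have hF : coeff 0 (tupleSeries W) = 1 := by
        have : tuplesWithSum (0 : ι →₀ ℕ) = {0} := by
          ext r
          simp [tuplesWithSum, descendingWithSum_zero, funext_iff]
        rw [coeff_tupleSeries, this, Finset.sum_singleton, hW.zero]
      rw [coeff_zero_eq_constantCoeff_apply] at hF ⊢
      rw [map_mul, hF, hP, map_prod, Finset.prod_congr rfl hconst]
      simp
    · rw [coeff_eq_zero_of_reflectsTo_self hadj hpos hinvariant hd, coeff_one, if_neg hd]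
  calc tupleSeries W = tupleSeries W * P * ∏ c ∈ Φ, monomialSubst c (descSeries q 0) := by
        rw [mul_assoc, hP, ← Finset.prod_mul_distrib, Finset.prod_congr rfl fun c hc =>
          (mul_comm _ _).trans (hinv c hc)]
        simp
    _ = _ := by rw [hone, one_mul]

end tupleSeries

section E6

/-- The adjacency matrix of the Dynkin diagram of type `E₆`. -/
def adjE6 (i j : Fin 6) : ℕ := (-cartanE6 i j).toNat

theorem adjE6_self (i : Fin 6) : adjE6 i i = 0 := by
  fin_cases i <;> rfl

/-- Half of the quadratic form of the Cartan matrix of type `E₆`. -/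
def formE6 (x : Fin 6 → ℤ) : ℤ :=
  ∑ i, x i ^ 2 - (x 0 * x 1 + x 1 * x 2 + x 2 * x 3 + x 3 * x 4 + x 2 * x 5)

theorem sum_cartanE6 (x : Fin 6 → ℤ) : ∑ i, ∑ j, x i * cartanE6 i j * x j = 2 * formE6 x := by
  simp [formE6, Fin.sum_univ_succ, cartanE6]
  ring

theorem formE6_eq (x : Fin 6 → ℤ) : 12 * formE6 x
    = 3 * (2 * x 0 - x 1) ^ 2 + (3 * x 1 - 2 * x 2) ^ 2 + 3 * (2 * x 4 - x 3) ^ 2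
      + (3 * x 3 - 2 * x 2) ^ 2 + 3 * (2 * x 5 - x 2) ^ 2 + x 2 ^ 2 := by
  simp [formE6, Fin.sum_univ_succ]
  ring

theorem formE6_nonneg (x : Fin 6 → ℤ) : 0 ≤ formE6 x := by
  have h := formE6_eq x
  have : 0 ≤ 12 * formE6 x := by rw [h]; positivity
  omega

theorem formE6_update (x : Fin 6 → ℤ) (i : Fin 6) (y : ℤ) (hx : x i = 0) :
    formE6 (Function.update x i y) = formE6 x + y ^ 2 - (∑ j, (adjE6 i j : ℤ) * x j) * y := by
  fin_cases i <;> simp at hx <;>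
    simp [formE6, Fin.sum_univ_succ, adjE6, cartanE6, hx, Function.update_apply] <;>
    ring

theorem exists_adjE6_lt (d : Fin 6 →₀ ℕ) (hd : d ≠ 0) :
    ∃ i, ∑ j, adjE6 i j * d j < 2 * d i := by
  by_contra! h
  refine hd ?_
  simp only [Fin.forall_fin_succ, Fin.sum_univ_succ, adjE6, cartanE6] at h
  simp at h
  ext i
  fin_cases i <;> simp <;> omega

theorem eq_zero_of_formE6_eq_zero {x : Fin 6 → ℤ} (hx : formE6 x = 0) : x = 0 := by
  have hsq := formE6_eq x
  rw [hx] at hsq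
  have h2 : x 2 = 0 := by nlinarith
  have h1 : 3 * x 1 - 2 * x 2 = 0 := by nlinarith
  have h3 : 3 * x 3 - 2 * x 2 = 0 := by nlinarith
  have h0 : 2 * x 0 - x 1 = 0 := by nlinarith
  have h4 : 2 * x 4 - x 3 = 0 := by nlinarith
  have h5 : 2 * x 5 - x 2 = 0 := by nlinarith
  funext i
  fin_cases i <;> simp <;> omega

theorem card_eq_of_mem_iff_formE6 {Φ : Finset (Fin 6 → ℕ)}
    (hΦ : ∀ c, c ∈ Φ ↔ formE6 (fun i => (c i : ℤ)) = 1) : Φ.card = 36 := by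
  have hbox : ((Finset.range 3 ×ˢ Finset.range 4 ×ˢ Finset.range 4 ×ˢ Finset.range 4
      ×ˢ Finset.range 3 ×ˢ Finset.range 3).filter fun (a, b, c, d, e, f) =>
        a * a + b * b + c * c + d * d + e * e + f * f
          = 1 + a * b + b * c + c * d + d * e + c * f).card = 36 := by
    decide +kernel
  rw [← hbox]
  refine Finset.card_nbij' (fun c => (c 0, c 1, c 2, c 3, c 4, c 5))
    (fun (a, b, c, d, e, f) => ![a, b, c, d, e, f]) ?_ ?_ ?_ ?_
  · intro c hc
    rw [Finset.mem_coe, hΦ] at hc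
    have hsq := formE6_eq fun i => (c i : ℤ)
    rw [hc] at hsq
    have h2 : (c 2 : ℤ) < 4 := by nlinarith
    have h1 : 3 * (c 1 : ℤ) - 2 * c 2 < 4 := by nlinarith
    have h3 : 3 * (c 3 : ℤ) - 2 * c 2 < 4 := by nlinarith
    have h0 : 2 * (c 0 : ℤ) - c 1 < 3 := by nlinarith
    have h4 : 2 * (c 4 : ℤ) - c 3 < 3 := by nlinarith
    have h5 : 2 * (c 5 : ℤ) - c 2 < 3 := by nlinarith
    simp only [Finset.coe_filter, Finset.mem_product, Finset.mem_range, Set.mem_ofPred_eq]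
    refine ⟨⟨by omega, by omega, by omega, by omega, by omega, by omega⟩, ?_⟩
    simp [formE6, Fin.sum_univ_succ] at hc
    zify
    linarith
  · rintro ⟨a, b, c, d, e, f⟩ h
    simp only [Finset.coe_filter, Set.mem_ofPred_eq] at h
    rw [Finset.mem_coe, hΦ]
    have h' := h.2
    zify at h'
    simp [formE6, Fin.sum_univ_succ]
    linarith
  · intro c _
    funext i
    fin_cases i <;> rfl
  · rintro ⟨a, b, c, d, e, f⟩ _
    rfl

theorem exists_isReflection_of_formE6_eq_one (i : Fin 6) {c : Fin 6 →₀ ℕ}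
    (hc : formE6 (fun j => (c j : ℤ)) = 1) (hi : c ≠ Finsupp.single i 1) :
    ∃ b : Fin 6 →₀ ℕ, formE6 (fun j => (b j : ℤ)) = 1 ∧ IsReflection adjE6 i c b := by
  set x : Fin 6 → ℤ := Function.update (fun j => (c j : ℤ)) i 0 with hx
  have hsum : ∑ j, (adjE6 i j : ℤ) * x j = ∑ j, (adjE6 i j : ℤ) * c j := by
    refine Finset.sum_congr rfl fun j _ => ?_
    by_cases hj : j = i
    · simp [hj, adjE6_self]
    · simp [hx, hj]
  have key : ∀ y : ℤ, formE6 (Function.update (fun j => (c j : ℤ)) i y)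
      = formE6 x + y ^ 2 - (∑ j, (adjE6 i j : ℤ) * c j) * y := fun y => by
    rw [← hsum, ← formE6_update x i y (by simp [hx])]
    simp [hx]
  have hle : c i ≤ ∑ j, adjE6 i j * c j := by
    by_contra! hlt
    zify at hlt
    have hs : (0 : ℤ) ≤ ∑ j, (adjE6 i j : ℤ) * c j := by positivity
    have h1 := key (c i)
    rw [Function.update_eq_self, hc] at h1
    have h2 := formE6_nonneg x
    have h3 : (c i : ℤ) = 1 := by nlinarith
    have h4 : formE6 x = 0 := by nlinarith
    refine hi (Finsupp.ext fun j => ?_)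
    by_cases hj : j = i
    · subst hj
      simpa using h3
    · have := congrFun (eq_zero_of_formE6_eq_zero h4) j
      simpa [hx, hj] using this
  refine ⟨c.update i (∑ j, adjE6 i j * c j - c i), ?_, fun j hj => ?_, ?_⟩
  · rw [← hc]
    have h1 := key (∑ j, (adjE6 i j : ℤ) * c j - c i)
    have h2 := key (c i)
    rw [Function.update_eq_self] at h2
    rw [h2]
    convert h1 using 1
    · congr 1
      funext j
      by_cases hj : j = i
      · subst hj
        simp [hle]
      · simp [hj, Finsupp.update_apply]
    · ring
  · simp [Finsupp.update_apply, hj]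
  · simp [Finsupp.update_apply, hle]

/-- The exponent of `q` attached to a tuple of descending sequences in type `E₆`. -/
noncomputable def exponentE6 (r : Fin 6 → ℕ → ℕ) : ℤ := ∑ᶠ t, formE6 fun i => (r i t : ℤ)

theorem exponentE6_nonneg (r : Fin 6 → ℕ → ℕ) : 0 ≤ exponentE6 r :=
  finsum_nonneg fun _ => formE6_nonneg _

theorem formE6_zero : formE6 0 = 0 := by simp [formE6]

theorem exponentE6_eq_range {r : Fin 6 → ℕ → ℕ} {L : ℕ} (h : ∀ i, ∀ t ≥ L, r i t = 0) :
    exponentE6 r = ∑ t ∈ Finset.range L, formE6 fun i => (r i t : ℤ) := by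
  refine finsum_eq_sum_range fun t ht => ?_
  have : (fun i => (r i t : ℤ)) = 0 := by
    funext i
    simp [h i t ht]
  rw [this, formE6_zero]

theorem exists_forall_eq_zero {ι : Type*} [Fintype ι] {r : ι → ℕ → ℕ}
    (hr : ∀ i, IsDescending (r i)) : ∃ L, ∀ i, ∀ t ≥ L, r i t = 0 := by
  choose N hN using fun i => (hr i).2
  exact ⟨∑ i, N i, fun i t ht => hN i t
    ((Finset.single_le_sum (fun _ _ => Nat.zero_le _) (Finset.mem_univ i)).trans ht)⟩

theorem exponentE6_eq {r : Fin 6 → ℕ → ℕ} (hr : ∀ i, IsDescending (r i)) :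
    exponentE6 r = (∑ i : Fin 6, ∑ᶠ t : ℕ, (r i t : ℤ) ^ 2)
        - ∑ᶠ t : ℕ, ((r 0 t : ℤ) * (r 1 t : ℤ) + (r 1 t : ℤ) * (r 2 t : ℤ)
            + (r 2 t : ℤ) * (r 3 t : ℤ) + (r 3 t : ℤ) * (r 4 t : ℤ)
            + (r 2 t : ℤ) * (r 5 t : ℤ)) := by
  obtain ⟨L, hL⟩ := exists_forall_eq_zero hr
  rw [exponentE6_eq_range hL,
    Finset.sum_congr rfl fun i _ => finsum_eq_sum_range (f := fun t => (r i t : ℤ) ^ 2) (L := L)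
      fun t ht => by simp [hL i t ht],
    finsum_eq_sum_range (L := L) fun t ht => by simp [hL _ t ht], Finset.sum_comm,
    ← Finset.sum_sub_distrib]
  rfl

theorem exponentE6_update {r : Fin 6 → ℕ → ℕ} {i : Fin 6} {l : ℕ → ℕ}
    (hr : ∀ j, IsDescending (r j)) (hi : r i = 0) (hl : IsDescending l) :
    exponentE6 (Function.update r i l) = exponentE6 r
      + (sumSq l - pairing (fun t => (adjSum adjE6 i r t : ℤ)) l) := by
  obtain ⟨L, hL⟩ := exists_forall_eq_zero hr
  obtain ⟨M, hM⟩ := hl.2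
  have hL' : ∀ j, ∀ t ≥ L + M, r j t = 0 := fun j t ht => hL j t (by omega)
  have hM' : ∀ t ≥ L + M, l t = 0 := fun t ht => hM t (by omega)
  have hupd : ∀ j, ∀ t ≥ L + M, Function.update r i l j t = 0 := fun j t ht => by
    by_cases hj : j = i
    · subst hj
      simpa using hM' t ht
    · simpa [hj] using hL' j t ht
  rw [exponentE6_eq_range hL', exponentE6_eq_range hupd, sumSq_eq_range hM',
    pairing_eq_range _ hM', ← Finset.sum_sub_distrib, ← Finset.sum_add_distrib]
  refine Finset.sum_congr rfl fun t _ => ?_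
  have h := formE6_update (fun j => (r j t : ℤ)) i (l t) (by simp [hi])
  have h' : (fun j => (Function.update r i l j t : ℤ))
      = Function.update (fun j => (r j t : ℤ)) i (l t) := by
    funext j
    by_cases hj : j = i
    · subst hj
      simp
    · simp [hj]
  rw [h', h]
  simp [adjSum]
  ring

/-- The weight of a tuple of descending sequences in type `E₆`. -/
noncomputable def weightE6 {K : Type*} [Field K] (q : K) (r : Fin 6 → ℕ → ℕ) : K :=
  q ^ exponentE6 r * ∏ i, (pochProd q (r i))⁻¹

theorem isTupleWeight_weightE6 {K : Type*} [Field K] {q : K} (hq0 : q ≠ 0) :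
    IsTupleWeight q adjE6 (weightE6 q) := by
  have hpoch : pochProd q 0 = 1 := by simp [pochProd, qPoch]
  refine ⟨?_, fun r i l hr hi hl => ?_⟩
  · have : exponentE6 0 = 0 := by
      rw [exponentE6_eq_range (L := 0) (by simp)]
      simp
    simp [weightE6, this, hpoch]
  · rw [weightE6, weightE6, exponentE6_update hr hi hl, zpow_add₀ hq0,
      ← Finset.mul_prod_erase _ _ (Finset.mem_univ i),
      ← Finset.mul_prod_erase _ (fun j => (pochProd q (r j))⁻¹) (Finset.mem_univ i), hi, hpoch,
      Finset.prod_congr rfl fun j hj => by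
        rw [Function.update_of_ne (Finset.ne_of_mem_erase hj)]]
    simp only [Function.update_self]
    ring

end E6

section separate

variable {n : ℕ} {R : Type*} [CommRing R]

/-- Multivariate power series as power series in the last variables whose coefficients are power
series in the variable `X 0`. -/
noncomputable def separateZero (n : ℕ) (R : Type*) [CommRing R] :
    MvPowerSeries (Fin (n + 1)) R ≃+* MvPowerSeries (Fin n) (PowerSeries R) where
  toFun f := fun d => PowerSeries.mk fun k => coeff (Finsupp.cons k d) f
  invFun g := fun D => PowerSeries.coeff (D 0) (coeff D.tail g)
  left_inv f := by
    ext D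
    change PowerSeries.coeff (D 0) (PowerSeries.mk fun k => coeff (Finsupp.cons k D.tail) f) = _
    rw [PowerSeries.coeff_mk, Finsupp.cons_tail]
  right_inv g := by
    ext d k
    change PowerSeries.coeff k (PowerSeries.mk fun k => PowerSeries.coeff (Finsupp.cons k d 0)
      (coeff (Finsupp.cons k d).tail g)) = _
    rw [PowerSeries.coeff_mk, Finsupp.tail_cons, Finsupp.cons_zero]
  map_add' f g := by
    ext d k
    change PowerSeries.coeff k (PowerSeries.mk fun k => coeff (Finsupp.cons k d) (f + g))
      = PowerSeries.coeff k ((PowerSeries.mk fun k => coeff (Finsupp.cons k d) f)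
        + PowerSeries.mk fun k => coeff (Finsupp.cons k d) g)
    simp
  map_mul' f g := by
    ext d k
    refine Eq.trans ?_ (congrArg (PowerSeries.coeff k) (coeff_mul d _ _).symm)
    rw [map_sum]
    change PowerSeries.coeff k (PowerSeries.mk fun k => coeff (Finsupp.cons k d) (f * g))
      = ∑ p ∈ Finset.HasAntidiagonal.antidiagonal d, PowerSeries.coeff k
        ((PowerSeries.mk fun k => coeff (Finsupp.cons k p.1) f)
          * PowerSeries.mk fun k => coeff (Finsupp.cons k p.2) g)
    rw [PowerSeries.coeff_mk, ← coeff_coeff_finSuccEquiv, map_mul, PowerSeries.coeff_mul, map_sum]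
    simp only [coeff_mul, PowerSeries.coeff_mul, PowerSeries.coeff_mk, ← coeff_coeff_finSuccEquiv]
    rw [Finset.sum_comm]

theorem coeff_separateZero (f : MvPowerSeries (Fin (n + 1)) R) (d : Fin n →₀ ℕ) (k : ℕ) :
    PowerSeries.coeff k (coeff d (separateZero n R f)) = coeff (Finsupp.cons k d) f := by
  change PowerSeries.coeff k (PowerSeries.mk fun k => coeff (Finsupp.cons k d) f) = _
  rw [PowerSeries.coeff_mk]

theorem coeff_separateZero_symm (g : MvPowerSeries (Fin n) (PowerSeries R)) (D : Fin (n + 1) →₀ ℕ) :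
    coeff D ((separateZero n R).symm g) = PowerSeries.coeff (D 0) (coeff D.tail g) := rfl

theorem separateZero_X_zero : separateZero n R (X 0) = C PowerSeries.X := by
  ext d k
  rw [coeff_separateZero, ← coeff_coeff_finSuccEquiv, finSuccEquiv_X_zero, PowerSeries.coeff_X,
    coeff_C]
  split_ifs with h1 h2 h2 <;> simp [PowerSeries.coeff_X, coeff_one, h1, h2]

theorem separateZero_X_succ (i : Fin n) : separateZero n R (X i.succ) = X i := by
  ext d k
  rw [coeff_separateZero, ← coeff_coeff_finSuccEquiv, finSuccEquiv_X_succ, PowerSeries.coeff_C,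
    coeff_X]
  split_ifs with h1 h2 h2 <;> simp [PowerSeries.coeff_one, coeff_X, h1, h2]

theorem prod_X_pow_eq_monomial {ι : Type*} [Fintype ι] (d : ι →₀ ℕ) :
    ∏ i, (X i : MvPowerSeries ι R) ^ d i = monomial d 1 := by
  rw [monomial_eq', Finsupp.prod_fintype _ _ (by simp)]
  simp

end separate

section inverse

variable {R S : Type*} [CommRing R] [CommRing S]

theorem map_inverse_of_isUnit (f : R →+* S) {a : R} (ha : IsUnit a) :
    f (Ring.inverse a) = Ring.inverse (f a) := by
  obtain ⟨u, rfl⟩ := ha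
  rw [Ring.inverse_unit]
  exact (Ring.inverse_unit (Units.map (f : R →* S) u)).symm

theorem isUnit_qPoch {q : R} (hq : ∀ n : ℕ, IsUnit (1 - q ^ (n + 1))) (m : ℕ) :
    IsUnit (qPoch q m) := by
  induction m with
  | zero => simp [qPoch_zero]
  | succ m ih =>
    rw [qPoch_succ]
    exact ih.mul (hq m)

theorem map_qPoch (f : R →+* S) (q : R) (m : ℕ) : f (qPoch q m) = qPoch (f q) m := by
  simp [qPoch]

/-- The inverse of `pochProd q l`. -/
noncomputable def invPochProd (q : R) (l : ℕ → ℕ) : R :=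
  ∏ᶠ j, Ring.inverse (qPoch q (l j - l (j + 1)))

theorem invPochProd_eq_range (q : R) {l : ℕ → ℕ} {L : ℕ} (h : ∀ t ≥ L, l t = 0) :
    invPochProd q l = ∏ j ∈ Finset.range L, Ring.inverse (qPoch q (l j - l (j + 1))) :=
  finprod_eq_prod_range fun t ht => by simp [h t ht, qPoch_zero]

theorem map_invPochProd (f : R →+* S) {q : R} (hq : ∀ n : ℕ, IsUnit (1 - q ^ (n + 1)))
    {l : ℕ → ℕ} (hl : IsDescending l) : f (invPochProd q l) = invPochProd (f q) l := by
  obtain ⟨L, hL⟩ := hl.2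
  rw [invPochProd_eq_range q hL, invPochProd_eq_range (f q) hL, map_prod]
  exact Finset.prod_congr rfl fun j _ => by
    rw [map_inverse_of_isUnit f (isUnit_qPoch hq _), map_qPoch]

theorem invPochProd_eq_inv {K : Type*} [Field K] (q : K) {l : ℕ → ℕ} (hl : IsDescending l) :
    invPochProd q l = (pochProd q l)⁻¹ := by
  obtain ⟨L, hL⟩ := hl.2
  rw [invPochProd_eq_range q hL, pochProd_eq_range q hL, ← Finset.prod_inv_distrib]
  exact Finset.prod_congr rfl fun j _ => Ring.inverse_eq_inv _

end inverse

section eulerSeries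

variable {R : Type*} [CommRing R] {q : R}

/-- The series `∑ q^N z^N / (q;q)_N`. -/
noncomputable def eulerSeries (q : R) : PowerSeries R :=
  PowerSeries.mk fun N => q ^ N * Ring.inverse (qPoch q N)

theorem one_sub_mul_eulerSeries (hq : ∀ n : ℕ, IsUnit (1 - q ^ (n + 1))) :
    (1 - PowerSeries.C q * PowerSeries.X) * eulerSeries q
      = PowerSeries.rescale q (eulerSeries q) := by
  ext N
  rw [sub_mul, one_mul, map_sub, mul_assoc, PowerSeries.coeff_C_mul, PowerSeries.coeff_rescale]
  cases N with
  | zero => simp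
  | succ N =>
    rw [PowerSeries.coeff_succ_X_mul]
    simp only [eulerSeries, PowerSeries.coeff_mk]
    rw [qPoch_succ, Ring.mul_inverse_rev]
    have h := Ring.mul_inverse_cancel _ (hq N)
    linear_combination (q ^ (N + 1) * Ring.inverse (qPoch q N)) * h

theorem prod_one_sub_mul_eulerSeries (hq : ∀ n : ℕ, IsUnit (1 - q ^ (n + 1))) (n : ℕ) :
    (∏ i ∈ Finset.range n, (1 - PowerSeries.C (q ^ (i + 1)) * PowerSeries.X)) * eulerSeries q
      = PowerSeries.rescale (q ^ n) (eulerSeries q) := by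
  induction n with
  | zero => simp [PowerSeries.rescale_one]
  | succ n ih =>
    have hC : PowerSeries.rescale (q ^ n) (PowerSeries.C q) = PowerSeries.C q := by
      ext N
      cases N <;> simp [PowerSeries.coeff_C]
    have hX : PowerSeries.rescale (q ^ n) (1 - PowerSeries.C q * PowerSeries.X)
        = 1 - PowerSeries.C (q ^ (n + 1)) * PowerSeries.X := by
      rw [map_sub, map_one, map_mul, PowerSeries.rescale_X, hC, pow_succ',
        map_mul, mul_assoc]
    rw [Finset.prod_range_succ, mul_right_comm, ih, mul_comm, ← hX, ← map_mul,
      one_sub_mul_eulerSeries hq, pow_succ', PowerSeries.rescale_mul]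
    rfl

theorem exists_rescale_eulerSeries (q : R) (n : ℕ) :
    ∃ U, PowerSeries.rescale (q ^ n) (eulerSeries q) = 1 + PowerSeries.C (q ^ n) * U := by
  refine ⟨PowerSeries.mk fun N => if N = 0 then 0 else
    (q ^ n) ^ (N - 1) * PowerSeries.coeff N (eulerSeries q), ?_⟩
  ext N
  rw [PowerSeries.coeff_rescale, map_add, PowerSeries.coeff_C_mul, PowerSeries.coeff_mk,
    PowerSeries.coeff_one]
  cases N with
  | zero => simp [eulerSeries, qPoch_zero]
  | succ N =>
    simp
    ring

end eulerSeries

theorem t2Space_mvPowerSeries {σ R : Type*} [TopologicalSpace R] [T2Space R] :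
    T2Space (MvPowerSeries σ R) :=
  inferInstanceAs (T2Space ((σ →₀ ℕ) → R))

section topology

variable {σ R : Type*} [CommRing R] [TopologicalSpace R]

theorem hasSum_of_hasSum_coeff {β : Type*} {f : β → MvPowerSeries σ R} {g : MvPowerSeries σ R}
    (h : ∀ d, HasSum (fun b => coeff d (f b)) (coeff d g)) : HasSum f g :=
  Pi.hasSum.mpr h

end topology

theorem isUnit_one_sub_of_constantCoeff {σ R : Type*} [CommRing R] {f : MvPowerSeries σ R}
    (hf : constantCoeff f = 0) : IsUnit (1 - f) := by
  rw [isUnit_iff_constantCoeff, map_sub, hf]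
  simp

theorem isUnit_one_sub_X_pow (n : ℕ) :
    IsUnit (1 - (PowerSeries.X : PowerSeries ℤ) ^ (n + 1)) := by
  rw [PowerSeries.isUnit_iff_constantCoeff]
  simp

section product

variable {n : ℕ}

/-- The Euler product with `z = y^c` as a power series in `q` and `y`. -/
noncomputable def eulerProduct (c : Fin n →₀ ℕ) : MvPowerSeries (Fin (n + 1)) ℤ :=
  (separateZero n ℤ).symm (monomialSubst c (eulerSeries PowerSeries.X))

theorem separateZero_prod_X_succ (c : Fin n →₀ ℕ) :
    separateZero n ℤ (∏ i, X i.succ ^ c i) = monomial c 1 := by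
  rw [map_prod, ← prod_X_pow_eq_monomial]
  simp [separateZero_X_succ]

theorem exists_prod_mul_eulerProduct {c : Fin n →₀ ℕ} (hc : c ≠ 0) (m : ℕ) :
    ∃ U, (∏ k ∈ Finset.range m, (1 - X 0 ^ (k + 1) * ∏ i : Fin n, X i.succ ^ c i))
      * eulerProduct c = 1 + X 0 ^ m * U := by
  obtain ⟨U, hU⟩ := exists_rescale_eulerSeries (PowerSeries.X : PowerSeries ℤ) m
  refine ⟨(separateZero n ℤ).symm (monomialSubst c U), (separateZero n ℤ).injective ?_⟩
  have h := congrArg (monomialSubst c)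
    ((prod_one_sub_mul_eulerSeries isUnit_one_sub_X_pow m).trans hU)
  have hX : ∀ k : ℕ, monomialSubst c
      (1 - PowerSeries.C ((PowerSeries.X : PowerSeries ℤ) ^ (k + 1)) * PowerSeries.X)
        = 1 - C PowerSeries.X ^ (k + 1) * monomial c 1 := fun k => by
    rw [eq_sub_iff_add_eq, ← map_pow, ← monomialSubst_C hc, ← monomialSubst_X hc,
      ← monomialSubst_mul hc, ← monomialSubst_add hc, sub_add_cancel, monomialSubst_one hc]
  have hprod : ∀ s : Finset ℕ, monomialSubst c (∏ k ∈ s,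
      (1 - PowerSeries.C ((PowerSeries.X : PowerSeries ℤ) ^ (k + 1)) * PowerSeries.X))
        = ∏ k ∈ s, (1 - C PowerSeries.X ^ (k + 1) * monomial c 1) := fun s => by
    induction s using Finset.induction_on with
    | empty => simpa using monomialSubst_one hc
    | insert a s ha ih =>
      rw [Finset.prod_insert ha, Finset.prod_insert ha, monomialSubst_mul hc, hX, ih]
  rw [monomialSubst_mul hc, hprod, monomialSubst_add hc, monomialSubst_one hc,
    monomialSubst_mul hc, monomialSubst_C hc, map_pow] at h
  simp only [eulerProduct, map_mul, map_prod, map_sub, map_add, map_one, map_pow,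
    separateZero_X_zero, separateZero_X_succ, prod_X_pow_eq_monomial, RingEquiv.apply_symm_apply]
  exact h

theorem hasProd_eulerProduct {c : Fin n →₀ ℕ} (hc : c ≠ 0) :
    HasProd (fun k : ℕ => Ring.inverse (1 - (X 0 : MvPowerSeries (Fin (n + 1)) ℤ) ^ (k + 1)
      * ∏ i : Fin n, (X i.succ : MvPowerSeries (Fin (n + 1)) ℤ) ^ c i)) (eulerProduct c) := by
  set a : ℕ → MvPowerSeries (Fin (n + 1)) ℤ := fun k => 1 - X 0 ^ (k + 1)
    * ∏ i : Fin n, X i.succ ^ c i with ha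
  have hunit : ∀ k, IsUnit (a k) := fun k => isUnit_one_sub_of_constantCoeff (by simp)
  refine tendsto_pi_nhds.mpr fun D => tendsto_const_nhds.congr' ?_
  filter_upwards [Filter.eventually_ge_atTop (Finset.range (D 0 + 1))] with s hs
  set π := Ideal.Quotient.mk (Ideal.span {(X 0 : MvPowerSeries (Fin (n + 1)) ℤ) ^ (D 0 + 1)})
  have hzero : π (X 0 ^ (D 0 + 1)) = 0 :=
    Ideal.Quotient.eq_zero_iff_mem.mpr (Ideal.mem_span_singleton_self _)
  have htail : ∀ k ∈ s, k ∉ Finset.range (D 0 + 1) → π (Ring.inverse (a k)) = 1 := by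
    intro k _ hk
    rw [Finset.mem_range, not_lt] at hk
    have hpow : π (X 0 ^ (k + 1)) = 0 := Ideal.Quotient.eq_zero_iff_mem.mpr
      (Ideal.mem_span_singleton.mpr (pow_dvd_pow _ (by omega)))
    rw [map_inverse_of_isUnit π (hunit k), ha]
    simp only [map_sub, map_one, map_mul, hpow, zero_mul, sub_zero, Ring.inverse_one]
  have hmod : π (∏ k ∈ s, Ring.inverse (a k)) = π (eulerProduct c) := by
    obtain ⟨U, hU⟩ := exists_prod_mul_eulerProduct hc (D 0 + 1)
    have h1 := congrArg π hU
    rw [map_mul, map_add, map_mul, hzero, map_one, zero_mul, add_zero] at h1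
    have h2 : (∏ k ∈ Finset.range (D 0 + 1), Ring.inverse (a k))
        * ∏ k ∈ Finset.range (D 0 + 1), a k = 1 := by
      rw [← Finset.prod_mul_distrib]
      exact Finset.prod_eq_one fun k _ => Ring.inverse_mul_cancel _ (hunit k)
    have h3 := congrArg π h2
    rw [map_mul, map_one, map_prod, Finset.prod_subset hs htail, ← map_prod] at h3
    rw [← mul_one (π (∏ k ∈ s, Ring.inverse (a k))), ← h1, ← mul_assoc, h3, one_mul]
  have hdvd := Ideal.mem_span_singleton.mp (Ideal.Quotient.eq.mp hmod)
  have := X_pow_dvd_iff.mp hdvd D (Nat.lt_succ_self _)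
  rw [map_sub, sub_eq_zero] at this
  exact this.symm

end product

section sum

/-- The weight of a tuple of descending sequences in type `E₆` as a power series in `q`. -/
noncomputable def seriesWeightE6 (r : Fin 6 → ℕ → ℕ) : PowerSeries ℤ :=
  PowerSeries.X ^ (exponentE6 r).toNat * ∏ i, invPochProd PowerSeries.X (r i)

/-- The sums of the entries of a tuple of sequences. -/
noncomputable def tupleSums {ι : Type*} [Finite ι] (r : ι → ℕ → ℕ) : ι →₀ ℕ :=
  Finsupp.equivFunOnFinite.symm fun i => ∑ᶠ t, r i t

/-- The generating function of tuples of descending sequences in type `E₆`, weighted by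
`seriesWeightE6`. -/
noncomputable def tupleSeriesE6 : MvPowerSeries (Fin 6) (PowerSeries ℤ) :=
  fun d => ∑ r ∈ tuplesWithSum d, seriesWeightE6 r

theorem coeff_tupleSeriesE6 (d : Fin 6 →₀ ℕ) :
    coeff d tupleSeriesE6 = ∑ r ∈ tuplesWithSum d, seriesWeightE6 r :=
  rfl

theorem separateZero_term {r : Fin 6 → ℕ → ℕ} (hr : ∀ i, IsDescending (r i)) :
    separateZero 6 ℤ (X 0 ^ (exponentE6 r).toNat * (∏ i, X i.succ ^ (∑ᶠ t, r i t))
      * ∏ i, invPochProd (X 0) (r i)) = monomial (tupleSums r) (seriesWeightE6 r) := by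
  have hX : ∀ k : ℕ, IsUnit (1 - (X 0 : MvPowerSeries (Fin 7) ℤ) ^ (k + 1)) := fun k =>
    isUnit_one_sub_of_constantCoeff (by simp)
  have hpoch : ∀ i, separateZero 6 ℤ (invPochProd (X 0) (r i))
      = C (invPochProd PowerSeries.X (r i)) := fun i => by
    rw [map_invPochProd C isUnit_one_sub_X_pow (hr i), ← separateZero_X_zero]
    exact map_invPochProd (separateZero 6 ℤ).toRingHom hX (hr i)
  have hmon : monomial (tupleSums r) (seriesWeightE6 r)
      = C (seriesWeightE6 r) * monomial (tupleSums r) (1 : PowerSeries ℤ) := by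
    rw [← monomial_zero_eq_C_apply, monomial_mul_monomial, zero_add, mul_one]
  rw [map_mul, map_mul, map_pow, separateZero_X_zero,
    show ∏ i : Fin 6, (X i.succ : MvPowerSeries (Fin 7) ℤ) ^ (∑ᶠ t, r i t)
      = ∏ i : Fin 6, X i.succ ^ tupleSums r i from rfl, separateZero_prod_X_succ, map_prod,
    Finset.prod_congr rfl fun i _ => hpoch i, hmon, seriesWeightE6, map_mul, map_pow, map_prod]
  ring

theorem hasSum_term :
    HasSum (fun r : {r : Fin 6 → ℕ → ℕ // ∀ i, IsDescending (r i)} =>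
      (X 0 : MvPowerSeries (Fin 7) ℤ) ^ (exponentE6 r.1).toNat
        * (∏ i : Fin 6, (X i.succ : MvPowerSeries (Fin 7) ℤ) ^ (∑ᶠ t, r.1 i t))
        * ∏ i : Fin 6, invPochProd (X 0) (r.1 i))
      ((separateZero 6 ℤ).symm tupleSeriesE6) := by
  classical
  refine hasSum_of_hasSum_coeff fun D => ?_
  have hcoeff : ∀ r : {r : Fin 6 → ℕ → ℕ // ∀ i, IsDescending (r i)},
      coeff D ((X 0 : MvPowerSeries (Fin 7) ℤ) ^ (exponentE6 r.1).toNat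
        * (∏ i : Fin 6, (X i.succ : MvPowerSeries (Fin 7) ℤ) ^ (∑ᶠ t, r.1 i t))
        * ∏ i : Fin 6, invPochProd (X 0) (r.1 i))
      = if r.1 ∈ tuplesWithSum D.tail then PowerSeries.coeff (D 0) (seriesWeightE6 r.1)
        else 0 := fun r => by
    have hiff : D.tail = tupleSums r.1 ↔ r.1 ∈ tuplesWithSum D.tail := by
      rw [mem_tuplesWithSum, DFunLike.ext_iff]
      exact forall_congr' fun i => ⟨fun h => ⟨r.2 i, h.symm⟩, fun h => h.2.symm⟩
    rw [← (separateZero 6 ℤ).symm_apply_apply (_ * _), separateZero_term r.2,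
      coeff_separateZero_symm, coeff_monomial]
    simp only [hiff]
    split_ifs <;> simp
  simp only [hcoeff]
  have hsum : coeff D ((separateZero 6 ℤ).symm tupleSeriesE6)
      = ∑ r ∈ (tuplesWithSum D.tail).subtype fun r => ∀ i, IsDescending (r i),
        if r.1 ∈ tuplesWithSum D.tail then PowerSeries.coeff (D 0) (seriesWeightE6 r.1)
        else 0 := by
    rw [Finset.sum_subtype_of_mem (fun r => if r ∈ tuplesWithSum D.tail then
      PowerSeries.coeff (D 0) (seriesWeightE6 r) else 0)
      fun r hr i => (mem_tuplesWithSum.mp hr i).1,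
      Finset.sum_congr rfl fun r hr => if_pos hr, ← map_sum, coeff_separateZero_symm,
      coeff_tupleSeriesE6]
  rw [hsum]
  exact hasSum_sum_of_ne_finset_zero fun r hr => if_neg fun h => hr (Finset.mem_subtype.mpr h)

end sum

section fractions

theorem map_monomialSubst {ι R S : Type*} [CommRing R] [CommRing S] (f : R →+* S) {c : ι →₀ ℕ}
    (hc : c ≠ 0) (g : PowerSeries R) :
    map f (monomialSubst c g) = monomialSubst c (PowerSeries.map f g) := by
  ext e
  rw [coeff_map]
  by_cases h : ∃ k : ℕ, e = k • c
  · obtain ⟨k, rfl⟩ := h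
    rw [coeff_smul_monomialSubst hc, coeff_smul_monomialSubst hc, PowerSeries.coeff_map]
  · rw [not_not.mp (mt (exists_smul_of_coeff_monomialSubst_ne_zero hc) h),
      not_not.mp (mt (exists_smul_of_coeff_monomialSubst_ne_zero hc) h), map_zero]

theorem map_injective_of_injective {σ R S : Type*} [CommRing R] [CommRing S] {f : R →+* S}
    (hf : Function.Injective f) : Function.Injective (map (σ := σ) f) := fun a b h => by
  ext d
  refine hf ?_
  rw [← coeff_map, ← coeff_map, h]

theorem equivFunOnFinite_symm_ne_zero {c : Fin 6 → ℕ} (hc : formE6 (fun i => (c i : ℤ)) = 1) :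
    Finsupp.equivFunOnFinite.symm c ≠ 0 := by
  intro h
  have h0 : c = 0 := funext fun i => DFunLike.congr_fun h i
  simp [h0, formE6] at hc

theorem prod_monomialSubst_eq_tupleSeriesE6 {Φ : Finset (Fin 6 → ℕ)}
    (hΦ : ∀ c, c ∈ Φ ↔ formE6 (fun i => (c i : ℤ)) = 1) :
    ∏ c ∈ Φ, monomialSubst (Finsupp.equivFunOnFinite.symm c) (eulerSeries PowerSeries.X)
      = tupleSeriesE6 := by
  set f : PowerSeries ℤ →+* FractionRing (PowerSeries ℤ) := algebraMap _ _
  have hf : Function.Injective f := IsFractionRing.injective _ _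
  set q := f PowerSeries.X with hq
  have hq0 : q ≠ 0 := by
    rw [hq, Ne, map_eq_zero_iff f hf]
    exact PowerSeries.X_ne_zero
  have hq1 : ∀ n : ℕ, q ^ (n + 1) ≠ 1 := fun n h => by
    rw [hq, ← map_pow, map_eq_one_iff f hf] at h
    simpa using congrArg PowerSeries.constantCoeff h
  have hne : ∀ c ∈ Φ, Finsupp.equivFunOnFinite.symm c ≠ 0 := fun c hc =>
    equivFunOnFinite_symm_ne_zero ((hΦ c).mp hc)
  have heuler : PowerSeries.map f (eulerSeries PowerSeries.X) = descSeries q 0 := by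
    ext N
    rw [PowerSeries.coeff_map, eulerSeries, descSeries, PowerSeries.coeff_mk, PowerSeries.coeff_mk,
      descSum_zero_right hq0 hq1, map_mul, map_pow,
      map_inverse_of_isUnit f (isUnit_qPoch isUnit_one_sub_X_pow N), map_qPoch,
      Ring.inverse_eq_inv, div_eq_mul_inv]
  have hweight : map f tupleSeriesE6 = tupleSeries (weightE6 q) := by
    ext d
    rw [coeff_map, coeff_tupleSeries, coeff_tupleSeriesE6, map_sum]
    refine Finset.sum_congr rfl fun r hr => ?_
    rw [mem_tuplesWithSum] at hr
    rw [seriesWeightE6, weightE6, map_mul, map_pow, map_prod, ← zpow_natCast,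
      Int.toNat_of_nonneg (exponentE6_nonneg r)]
    congr 1
    exact Finset.prod_congr rfl fun i _ => by
      rw [map_invPochProd f isUnit_one_sub_X_pow (hr i).1, invPochProd_eq_inv _ (hr i).1]
  refine map_injective_of_injective hf ?_
  rw [hweight, map_prod, Finset.prod_congr rfl fun c hc => by
    rw [map_monomialSubst f (hne c hc), heuler]]
  have hmem : ∀ c : Fin 6 →₀ ℕ, c ∈ Φ.map Finsupp.equivFunOnFinite.symm.toEmbedding
      ↔ formE6 (fun i => (c i : ℤ)) = 1 := fun c => by
    rw [Finset.mem_map_equiv, hΦ]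
    rfl
  rw [tupleSeries_eq_prod hq0 hq1 adjE6_self exists_adjE6_lt (isTupleWeight_weightE6 hq0)
    (Φ.map Finsupp.equivFunOnFinite.symm.toEmbedding), Finset.prod_map]
  · rfl
  · intro h
    obtain ⟨c, hc, h0⟩ := Finset.mem_map.mp h
    exact hne c hc h0
  · intro i
    rw [hmem]
    fin_cases i <;> simp [formE6, Finsupp.single_apply]
  · intro i c hc hi
    obtain ⟨b, hb, hcb⟩ := exists_isReflection_of_formE6_eq_one i ((hmem c).mp hc) hi
    exact ⟨b, (hmem b).mpr hb, hcb⟩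

end fractions

/-- The identity of Theorem 7.3 in type `E₆`.  With
`Φ⁺ = {c ∈ ℕ⁶ : cᵀ A c = 2}` (the 36 positive roots of `E₆`), in `ℤ[[q, y₁, …, y₆]]`
(variables indexed by `Fin 7`, `q = X 0`, `yᵢ = X i.succ`):
`∏_{c ∈ Φ⁺} ∏_{n ≥ 1} (1 - qⁿ y^c)⁻¹
  = ∑_{(r₁,…,r₆) descending} q^{E r} (∏ᵢ yᵢ^{|rᵢ|}) ∏ᵢ ∏_{j ≥ 1} (q;q)_{rᵢ^{(j)}-rᵢ^{(j+1)}}⁻¹`,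
with `E r = ∑_{i=1}^{6} ∑_{t≥1} (rᵢ^{(t)})²
 - ∑_{t≥1} (r₁r₂ + r₂r₃ + r₃r₄ + r₄r₅ + r₃r₆)^{(t)}`, a nonnegative integer. -/
theorem stmt_9
    (Φ : Finset (Fin 6 → ℕ))
    (hΦ : ∀ c : Fin 6 → ℕ, c ∈ Φ ↔ ∑ i, ∑ j, (c i : ℤ) * cartanE6 i j * (c j : ℤ) = 2)
    (E : (Fin 6 → ℕ → ℕ) → ℤ)
    (hE : ∀ r : Fin 6 → ℕ → ℕ, E r =
      (∑ i : Fin 6, ∑ᶠ t : ℕ, (r i t : ℤ) ^ 2)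
        - ∑ᶠ t : ℕ, ((r 0 t : ℤ) * (r 1 t : ℤ) + (r 1 t : ℤ) * (r 2 t : ℤ)
            + (r 2 t : ℤ) * (r 3 t : ℤ) + (r 3 t : ℤ) * (r 4 t : ℤ)
            + (r 2 t : ℤ) * (r 5 t : ℤ))) :
    Φ.card = 36
    ∧ (∀ r : Fin 6 → ℕ → ℕ, (∀ i, IsDescending (r i)) → 0 ≤ E r)
    ∧ (∏ c ∈ Φ, ∏' n : ℕ,
          Ring.inverse (1 - (X 0 : MvPowerSeries (Fin 7) ℤ) ^ (n + 1)
            * ∏ i : Fin 6, (X i.succ : MvPowerSeries (Fin 7) ℤ) ^ c i))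
      = ∑' r : {r : Fin 6 → ℕ → ℕ // ∀ i, IsDescending (r i)},
          (X 0 : MvPowerSeries (Fin 7) ℤ) ^ (E r.1).toNat
            * (∏ i : Fin 6, (X i.succ : MvPowerSeries (Fin 7) ℤ) ^ (∑ᶠ t : ℕ, r.1 i t))
            * ∏ i : Fin 6, ∏ᶠ j : ℕ,
                Ring.inverse (∏ u ∈ Finset.range (r.1 i j - r.1 i (j + 1)),
                  (1 - (X 0 : MvPowerSeries (Fin 7) ℤ) ^ (u + 1))) := by
  have hroot : ∀ c, c ∈ Φ ↔ formE6 (fun i => (c i : ℤ)) = 1 := fun c => by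
    rw [hΦ, sum_cartanE6]
    omega
  have hexp : ∀ r : Fin 6 → ℕ → ℕ, (∀ i, IsDescending (r i)) → E r = exponentE6 r := fun r hr =>
    (hE r).trans (exponentE6_eq hr).symm
  have : T2Space (MvPowerSeries (Fin 7) ℤ) := t2Space_mvPowerSeries
  refine ⟨card_eq_of_mem_iff_formE6 hroot, fun r hr => hexp r hr ▸ exponentE6_nonneg r, ?_⟩
  have hterm := hasSum_term.tsum_eq
  rw [← prod_monomialSubst_eq_tupleSeriesE6 hroot, map_prod] at hterm
  refine (Finset.prod_congr rfl fun c hc => (hasProd_eulerProduct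
    (equivFunOnFinite_symm_ne_zero ((hroot c).mp hc))).tprod_eq).trans (hterm.symm.trans ?_)
  refine tsum_congr fun r => ?_
  rw [hexp r.1 r.2]
  rfl
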